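/- Let I_1, I_2 be squarefree monomial ideals of S = K[x_1,…,x_n] such that X(I_1) ∩ X(I_2) = ∅, where X(I) is the set of variables appearing in the minimal monomial generators of I. If ara I_i = pd_S S/I_i holds for i = 1, 2, then ara(I_1 ∩ I_2) = pd_S S/(I_1 ∩ I_2). -/

import Mathlib

open CategoryTheory MvPolynomial

universe u

/-- The projective dimension (possibly `⊤`) of a module `M` over a commutative
ring `R`, via the standard characterization by vanishing of `Ext` groups. -/
noncomputable def pdim (R : Type u) [CommRing R] (M : ModuleCat.{u} R) : ℕ∞ :=
  sInf {n : ℕ∞ | ∀ k : ℕ, n < (k : ℕ∞) → ∀ N : ModuleCat.{u} R,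
    Subsingleton (((Ext R (ModuleCat.{u} R) k).obj (Opposite.op M)).obj N)}

/-- The arithmetical rank of an ideal. -/
noncomputable def ara {R : Type*} [CommRing R] (I : Ideal R) : ℕ :=
  sInf {r : ℕ | ∃ a : Fin r → R, (Ideal.span (Set.range a)).radical = I.radical}

/-!
Statement 10: if `I₁, I₂` are squarefree monomial ideals in disjoint sets of
variables and `ara Iᵢ = pd_S S/Iᵢ` for `i = 1, 2`, then
`ara (I₁ ∩ I₂) = pd_S S/(I₁ ∩ I₂)`.
-/

theorem subsingleton_Ext_succ_iff {R : Type u} [CommRing R] {M : ModuleCat.{u} R}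
    (P : ProjectiveResolution M) (N : ModuleCat.{u} R) (k : ℕ) :
    Subsingleton (((Ext R (ModuleCat.{u} R) (k + 1)).obj (Opposite.op M)).obj N) ↔
      ∀ f : P.complex.X (k + 1) ⟶ N, P.complex.d (k + 2) (k + 1) ≫ f = 0 →
        ∃ g : P.complex.X k ⟶ N, P.complex.d (k + 1) k ≫ g = f := by
  rw [← ModuleCat.isZero_iff_subsingleton, (P.isoExt (R := R) (k + 1) N).isZero_iff,
    ← HomologicalComplex.exactAt_iff_isZero_homology,
    HomologicalComplex.exactAt_iff' _ k (k + 1) (k + 2) (by simp) (by simp),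
    ShortComplex.moduleCat_exact_iff]
  rfl

theorem subsingleton_abelianExt_succ_iff {R : Type u} [CommRing R] {M : ModuleCat.{u} R}
    (P : ProjectiveResolution M) (N : ModuleCat.{u} R) (k : ℕ) :
    Subsingleton (Abelian.Ext M N (k + 1)) ↔
      ∀ f : P.complex.X (k + 1) ⟶ N, P.complex.d (k + 2) (k + 1) ≫ f = 0 →
        ∃ g : P.complex.X k ⟶ N, P.complex.d (k + 1) k ≫ g = f := by
  constructor
  · intro h f hf
    exact (P.extMk_eq_zero_iff f (k + 2) rfl hf k rfl).1 (Subsingleton.elim _ _)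
  · intro h
    refine subsingleton_of_forall_eq 0 fun α => ?_
    obtain ⟨f, hf, rfl⟩ := P.extMk_surjective α (k + 2) rfl
    exact (P.extMk_eq_zero_iff f (k + 2) rfl hf k rfl).2 (h f hf)

theorem pdim_le_iff {R : Type u} [CommRing R] (M : ModuleCat.{u} R) (m : ℕ) :
    pdim R M ≤ m ↔ HasProjectiveDimensionLT M (m + 1) := by
  have key : ∀ k : ℕ, (∀ N : ModuleCat.{u} R,
      Subsingleton (((Ext R (ModuleCat.{u} R) (k + 1)).obj (Opposite.op M)).obj N)) ↔
      ∀ N : ModuleCat.{u} R, Subsingleton (Abelian.Ext M N (k + 1)) := fun k =>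
    forall_congr' fun N => by
      have P := projectiveResolution M
      rw [subsingleton_Ext_succ_iff P, subsingleton_abelianExt_succ_iff P]
  rw [hasProjectiveDimensionLT_iff.{u}]
  have hmem : pdim R M ∈ {n : ℕ∞ | ∀ k : ℕ, n < (k : ℕ∞) → ∀ N : ModuleCat.{u} R,
      Subsingleton (((Ext R (ModuleCat.{u} R) k).obj (Opposite.op M)).obj N)} :=
    csInf_mem ⟨⊤, fun k hk => absurd hk (by simp)⟩
  constructor
  · intro h i hi N e
    obtain ⟨k, rfl⟩ : ∃ k, i = k + 1 := ⟨i - 1, by omega⟩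
    have := (key k).1 (hmem (k + 1) (lt_of_le_of_lt h (by exact_mod_cast hi))) N
    exact Subsingleton.elim _ _
  · intro h
    refine sInf_le fun k hk => ?_
    obtain ⟨j, rfl⟩ : ∃ j, k = j + 1 := ⟨k - 1, by have : m < k := by exact_mod_cast hk
                                                   omega⟩
    refine (key j).2 fun N => subsingleton_of_forall_eq 0 fun e => h _ ?_ e
    exact_mod_cast hk

section Syzygies

variable {R : Type u} [CommRing R]

theorem hasProjectiveDimensionLT_one_iff_projective (M : Type u) [AddCommGroup M] [Module R M] :
    HasProjectiveDimensionLT (ModuleCat.of R M) 1 ↔ Module.Projective R M := by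
  rw [IsProjective.iff_projective, projective_iff_hasProjectiveDimensionLT_one]

theorem hasProjectiveDimensionLT_succ_iff_of_exact {L P M : Type u} [AddCommGroup L] [Module R L]
    [AddCommGroup P] [Module R P] [AddCommGroup M] [Module R M] [Module.Projective R P]
    (d : L →ₗ[R] P) (π : P →ₗ[R] M) (hπ : Function.Surjective π) (hd : Function.Exact d π)
    (k : ℕ) :
    HasProjectiveDimensionLT (ModuleCat.of R M) (k + 2) ↔
      HasProjectiveDimensionLT (ModuleCat.of R (LinearMap.range d)) (k + 1) := by
  have hex : Function.Exact (LinearMap.range d).subtype π := fun x => by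
    rw [hd x]; simp
  let S := ModuleCat.shortComplexOfCompEqZero (LinearMap.range d).subtype π
    hex.linearMap_comp_eq_zero
  have hS : S.ShortExact := ModuleCat.shortComplex_shortExact S hex
    (LinearMap.range d).injective_subtype hπ
  exact hS.hasProjectiveDimensionLT_X₃_iff k
    (ModuleCat.projective_of_categoryTheory_projective (ModuleCat.of R P))

theorem exact_rangeRestrict {L P M : Type u} [AddCommGroup L] [Module R L]
    [AddCommGroup P] [Module R P] [AddCommGroup M] [Module R M]
    (e : L →ₗ[R] P) (d : P →ₗ[R] M) (h : Function.Exact e d) :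
    Function.Exact e d.rangeRestrict := fun x => by
  rw [← h x, Subtype.ext_iff]
  rfl

theorem exists_retraction_of_hasProjectiveDimensionLT (k : ℕ) (P : ℕ → Type u)
    [∀ i, AddCommGroup (P i)] [∀ i, Module R (P i)] [∀ i, Module.Projective R (P i)]
    (d : ∀ i, P (i + 1) →ₗ[R] P i) {M : Type u} [AddCommGroup M] [Module R M] (π : P 0 →ₗ[R] M)
    (hπ : Function.Surjective π) (h0 : Function.Exact (d 0) π)
    (hd : ∀ i, Function.Exact (d (i + 1)) (d i))
    (h : HasProjectiveDimensionLT (ModuleCat.of R M) (k + 1)) :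
    ∃ ρ : P k →ₗ[R] LinearMap.range (d k), ∀ x : LinearMap.range (d k), ρ x = x := by
  induction k generalizing P M with
  | zero =>
    have := (hasProjectiveDimensionLT_one_iff_projective M).1 h
    obtain ⟨s, hs⟩ := Module.projective_lifting_property π LinearMap.id hπ
    refine ⟨(LinearMap.id - s ∘ₗ π).codRestrict _ fun x => ?_, fun x => ?_⟩
    · ext
      have : π x = 0 := (h0 _).2 x.2
      simp [this]
    · have hx : π (x - s (π x)) = 0 := by
        rw [map_sub, sub_eq_zero]
        exact (LinearMap.congr_fun hs (π x)).symm
      exact (h0 _).1 hx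
  | succ k ih =>
    exact ih (fun i => P (i + 1)) (fun i => d (i + 1)) (d 0).rangeRestrict
      (d 0).surjective_rangeRestrict (exact_rangeRestrict _ _ (hd 0)) (fun i => hd (i + 1))
      ((hasProjectiveDimensionLT_succ_iff_of_exact (d 0) π hπ h0 k).1 h)

theorem hasProjectiveDimensionLT_of_retraction (k : ℕ) (P : ℕ → Type u)
    [∀ i, AddCommGroup (P i)] [∀ i, Module R (P i)] [∀ i, Module.Projective R (P i)]
    (d : ∀ i, P (i + 1) →ₗ[R] P i) {M : Type u} [AddCommGroup M] [Module R M] (π : P 0 →ₗ[R] M)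
    (hπ : Function.Surjective π) (h0 : Function.Exact (d 0) π)
    (hd : ∀ i, Function.Exact (d (i + 1)) (d i))
    (ρ : P k →ₗ[R] LinearMap.range (d k)) (hρ : ∀ x : LinearMap.range (d k), ρ x = x) :
    HasProjectiveDimensionLT (ModuleCat.of R M) (k + 1) := by
  induction k generalizing P M with
  | zero =>
    rw [zero_add, hasProjectiveDimensionLT_one_iff_projective]
    have hker : LinearMap.ker π ≤
        LinearMap.ker (LinearMap.id - (LinearMap.range (d 0)).subtype ∘ₗ ρ) := fun x hx => by
      obtain ⟨y, rfl⟩ := (h0 x).1 hx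
      simp [hρ ⟨_, LinearMap.mem_range_self (d 0) y⟩]
    let e := π.quotKerEquivOfSurjective hπ
    refine Module.Projective.of_split ((LinearMap.ker π).liftQ _ hker ∘ₗ e.symm.toLinearMap) π ?_
    ext m
    obtain ⟨x, rfl⟩ := hπ m
    have hx : e.symm (π x) = Submodule.Quotient.mk x := by
      rw [LinearEquiv.symm_apply_eq]; rfl
    have : π (ρ x : P 0) = 0 := (h0 _).2 (ρ x).2
    simp [hx, this]
  | succ k ih =>
    exact (hasProjectiveDimensionLT_succ_iff_of_exact (d 0) π hπ h0 k).2
      (ih (fun i => P (i + 1)) (fun i => d (i + 1)) (d 0).rangeRestrict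
        (d 0).surjective_rangeRestrict (exact_rangeRestrict _ _ (hd 0)) (fun i => hd (i + 1)) ρ hρ)

theorem projective_range_of_hasProjectiveDimensionLT (k : ℕ) (P : ℕ → Type u)
    [∀ i, AddCommGroup (P i)] [∀ i, Module R (P i)] [∀ i, Module.Projective R (P i)]
    (d : ∀ i, P (i + 1) →ₗ[R] P i) {M : Type u} [AddCommGroup M] [Module R M] (π : P 0 →ₗ[R] M)
    (hπ : Function.Surjective π) (h0 : Function.Exact (d 0) π)
    (hd : ∀ i, Function.Exact (d (i + 1)) (d i))
    (h : HasProjectiveDimensionLT (ModuleCat.of R M) (k + 2)) :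
    Module.Projective R (LinearMap.range (d k)) := by
  induction k generalizing P M with
  | zero =>
    exact (hasProjectiveDimensionLT_one_iff_projective _).1
      ((hasProjectiveDimensionLT_succ_iff_of_exact (d 0) π hπ h0 0).1 h)
  | succ k ih =>
    exact ih (fun i => P (i + 1)) (fun i => d (i + 1)) (d 0).rangeRestrict
      (d 0).surjective_rangeRestrict (exact_rangeRestrict _ _ (hd 0)) (fun i => hd (i + 1))
      ((hasProjectiveDimensionLT_succ_iff_of_exact (d 0) π hπ h0 (k + 1)).1 h)

end Syzygies

section Cochains

variable {Λ : Type*} [LinearOrder Λ]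

/-- The sign `(-1) ^ #{j ∈ s | j < i}` with which the face opposite to `i` occurs in the
boundary of the simplex `s`. -/
def faceSign (i : Λ) (s : Finset Λ) : ℤ := (-1) ^ (s.filter (· < i)).card

theorem faceSign_mul_self (i : Λ) (s : Finset Λ) : faceSign i s * faceSign i s = 1 := by
  rw [faceSign, ← pow_add, ← two_mul, pow_mul]; simp

theorem faceSign_smul_smul {M : Type*} [AddCommGroup M] (i : Λ) (s : Finset Λ) (x : M) :
    faceSign i s • faceSign i s • x = x := by
  rw [smul_smul, faceSign_mul_self, one_smul]

@[simp]
theorem faceSign_insert_self (i : Λ) (s : Finset Λ) :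
    faceSign i (insert i s) = faceSign i s := by
  simp [faceSign, Finset.filter_insert]

@[simp]
theorem faceSign_erase_self (i : Λ) (s : Finset Λ) :
    faceSign i (s.erase i) = faceSign i s := by
  rw [faceSign, faceSign, Finset.filter_erase, Finset.erase_eq_of_notMem (by simp)]

theorem faceSign_erase_of_not_lt {i j : Λ} (s : Finset Λ) (h : ¬ j < i) :
    faceSign i (s.erase j) = faceSign i s := by
  rw [faceSign, faceSign, Finset.filter_erase, Finset.erase_eq_of_notMem (by simp [h])]

theorem faceSign_erase_of_lt {i j : Λ} {s : Finset Λ} (hj : j ∈ s) (h : j < i) :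
    faceSign i (s.erase j) = -faceSign i s := by
  have hmem : j ∈ s.filter (· < i) := by simp [hj, h]
  rw [faceSign, faceSign, Finset.filter_erase, ← Finset.card_erase_add_one hmem, pow_succ]
  simp

theorem faceSign_mul_faceSign_erase {i j : Λ} {s : Finset Λ} (hi : i ∈ s) (hj : j ∈ s)
    (hij : i ≠ j) :
    faceSign i s * faceSign j (s.erase i) = -(faceSign j s * faceSign i (s.erase j)) := by
  rcases lt_or_gt_of_ne hij with h | h
  · rw [faceSign_erase_of_lt hi h, faceSign_erase_of_not_lt s h.not_gt]; ring
  · rw [faceSign_erase_of_not_lt s h.not_gt, faceSign_erase_of_lt hj h]; ring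

theorem faceSign_mul_faceSign_insert {i j : Λ} {t : Finset Λ} (hi : i ∈ t) (hj : j ∉ t) :
    faceSign j t * faceSign i (insert j t) = -(faceSign i t * faceSign j (t.erase i)) := by
  have hij : j ≠ i := fun h => hj (h ▸ hi)
  have h := faceSign_mul_faceSign_erase (Finset.mem_insert_self j t)
    (Finset.mem_insert_of_mem hi) hij
  rw [faceSign_insert_self, Finset.erase_insert hj, Finset.erase_insert_of_ne hij,
    faceSign_insert_self] at h
  linear_combination (faceSign i t * faceSign i (insert j t)) * h
    - (faceSign j t * faceSign i (insert j t)) * faceSign_mul_self i t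
    - (faceSign i t * faceSign j (t.erase i)) * faceSign_mul_self i (insert j t)

theorem sum_sum_erase_eq_zero {M : Type*} [AddCommGroup M] (s : Finset Λ) (F : Λ → Λ → M)
    (hF : ∀ i ∈ s, ∀ j ∈ s, i ≠ j → F i j = -F j i) :
    ∑ i ∈ s, ∑ j ∈ s.erase i, F i j = 0 := by
  rw [Finset.sum_sigma']
  refine Finset.sum_involution (fun x _ => ⟨x.2, x.1⟩) ?_ ?_ ?_ ?_
  · rintro ⟨i, j⟩ h
    simp only [Finset.mem_sigma, Finset.mem_erase] at h
    simp [hF i h.1 j h.2.2 h.2.1.symm]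
  · rintro ⟨i, j⟩ h _
    simp only [Finset.mem_sigma, Finset.mem_erase] at h
    simp [h.2.1]
  · rintro ⟨i, j⟩ h
    simp only [Finset.mem_sigma, Finset.mem_erase] at h ⊢
    exact ⟨h.2.2, h.2.1.symm, h.1⟩
  · rintro ⟨i, j⟩ h
    rfl

variable {M : Type*} [AddCommGroup M]

/-- The simplicial coboundary of a cochain on the finite subsets of `Λ`. -/
def cobdry (f : Finset Λ → M) (s : Finset Λ) : M :=
  ∑ i ∈ s, faceSign i s • f (s.erase i)

/-- The simplicial boundary of a chain on the simplex with vertex set `G`. -/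
def bdry (G : Finset Λ) (f : Finset Λ → M) (t : Finset Λ) : M :=
  ∑ i ∈ G \ t, faceSign i t • f (insert i t)

theorem cobdry_congr {f g : Finset Λ → M} {s : Finset Λ}
    (h : ∀ i ∈ s, f (s.erase i) = g (s.erase i)) : cobdry f s = cobdry g s :=
  Finset.sum_congr rfl fun i hi => by rw [h i hi]

theorem cobdry_add (f g : Finset Λ → M) (s : Finset Λ) :
    cobdry (fun t => f t + g t) s = cobdry f s + cobdry g s := by
  simp [cobdry, Finset.sum_add_distrib]

theorem cobdry_sub (f g : Finset Λ → M) (s : Finset Λ) :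
    cobdry (fun t => f t - g t) s = cobdry f s - cobdry g s := by
  simp [cobdry, smul_sub]

theorem map_cobdry {N F : Type*} [AddCommGroup N] [FunLike F M N] [AddMonoidHomClass F M N]
    (φ : F) (f : Finset Λ → M) (s : Finset Λ) :
    φ (cobdry f s) = cobdry (fun t => φ (f t)) s := by
  simp [cobdry, map_sum, map_zsmul]

theorem cobdry_cobdry (f : Finset Λ → M) (s : Finset Λ) : cobdry (cobdry f) s = 0 := by
  simp only [cobdry, Finset.smul_sum, smul_smul]
  refine sum_sum_erase_eq_zero s _ fun i hi j hj hij => ?_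
  rw [faceSign_mul_faceSign_erase hi hj hij, neg_smul, Finset.erase_right_comm]

theorem bdry_bdry (G : Finset Λ) (f : Finset Λ → M) (t : Finset Λ) :
    bdry G (bdry G f) t = 0 := by
  simp only [bdry, Finset.smul_sum, smul_smul]
  simp only [Finset.sdiff_insert]
  refine sum_sum_erase_eq_zero (G \ t) _ fun i hi j hj hij => ?_
  rw [← neg_smul, Finset.insert_comm]
  congr 1
  have h := faceSign_mul_faceSign_erase (Finset.mem_insert_self i (insert j t))
    (Finset.mem_insert_of_mem (Finset.mem_insert_self j t)) hij
  rw [faceSign_insert_self, Finset.erase_insert (by simp [hij, (Finset.mem_sdiff.1 hi).2]),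
    Finset.insert_comm, faceSign_insert_self, Finset.erase_insert
      (by simp [hij.symm, (Finset.mem_sdiff.1 hj).2]), faceSign_insert_self,
    faceSign_insert_self] at h
  linear_combination h

/-- `bdry` and `cobdry` with the faces twisted by `u` and `π` respectively are adjoint up to
the homotopy `∑ i ∈ G, u i * π i`. -/
theorem bdry_cobdry_homotopy (G : Finset Λ) (π u : Λ → M →+ M)
    (hπu : ∀ i j x, π i (u j x) = u j (π i x)) (f : Finset Λ → M) {t : Finset Λ} (ht : t ⊆ G) :
    (∑ j ∈ G \ t, faceSign j t • u j (∑ i ∈ insert j t,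
        faceSign i (insert j t) • π i (f ((insert j t).erase i)))) +
      (∑ i ∈ t, faceSign i t • π i (∑ j ∈ G \ t.erase i,
        faceSign j (t.erase i) • u j (f (insert j (t.erase i))))) =
      ∑ i ∈ G, u i (π i (f t)) := by
  have h1 : ∀ j ∈ G \ t, faceSign j t • u j (∑ i ∈ insert j t,
        faceSign i (insert j t) • π i (f ((insert j t).erase i))) = u j (π j (f t)) +
        ∑ i ∈ t, (faceSign j t * faceSign i (insert j t)) •
          u j (π i (f ((insert j t).erase i))) := fun j hj => by
    have hjt : j ∉ t := (Finset.mem_sdiff.1 hj).2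
    rw [Finset.sum_insert hjt, map_add, smul_add, faceSign_insert_self, map_zsmul,
      faceSign_smul_smul, Finset.erase_insert hjt, map_sum, Finset.smul_sum]
    simp only [map_zsmul, smul_smul]
  have h2 : ∀ i ∈ t, faceSign i t • π i (∑ j ∈ G \ t.erase i,
        faceSign j (t.erase i) • u j (f (insert j (t.erase i)))) = u i (π i (f t)) +
        ∑ j ∈ G \ t, (faceSign i t * faceSign j (t.erase i)) •
          u j (π i (f ((insert j t).erase i))) := fun i hi => by
    have hG : G \ t.erase i = insert i (G \ t) := by
      ext x
      simp only [Finset.mem_sdiff, Finset.mem_erase, Finset.mem_insert]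
      by_cases hx : x = i
      · subst hx; simp [ht hi]
      · simp [hx]
    rw [hG, Finset.sum_insert (by simp [hi]), map_add, smul_add, faceSign_erase_self, map_zsmul,
      faceSign_smul_smul, Finset.insert_erase hi, map_sum, Finset.smul_sum, hπu]
    congr 1
    refine Finset.sum_congr rfl fun j hj => ?_
    have hij : j ≠ i := fun h => (Finset.mem_sdiff.1 hj).2 (h ▸ hi)
    rw [map_zsmul, smul_smul, hπu, Finset.erase_insert_of_ne hij]
  rw [Finset.sum_congr rfl h1, Finset.sum_congr rfl h2, Finset.sum_add_distrib,
    Finset.sum_add_distrib, Finset.sum_comm (s := t), ← Finset.sum_sdiff ht,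
    add_add_add_comm, ← Finset.sum_add_distrib (s := G \ t) (f := fun j => ∑ i ∈ t, _)]
  refine add_eq_left.2 (Finset.sum_eq_zero fun j hj => ?_)
  rw [← Finset.sum_add_distrib]
  refine Finset.sum_eq_zero fun i hi => ?_
  rw [faceSign_mul_faceSign_insert hi (Finset.mem_sdiff.1 hj).2, neg_smul, neg_add_cancel]

end Cochains

section SquarefreeMonomials

variable {V : Type*} {K : Type*} [Field K]

/-- The indicator exponent of a set of variables. -/
noncomputable def indExp (W : Finset V) : V →₀ ℕ := ∑ v ∈ W, Finsupp.single v 1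

theorem indExp_apply [DecidableEq V] (W : Finset V) (v : V) :
    indExp W v = if v ∈ W then 1 else 0 := by
  simp [indExp, Finsupp.finsetSum_apply, Finsupp.single_apply]

theorem indExp_le_iff [DecidableEq V] (W : Finset V) (E : V →₀ ℕ) :
    indExp W ≤ E ↔ ∀ v ∈ W, E v ≠ 0 := by
  rw [Finsupp.le_def]
  refine forall_congr' fun v => ?_
  rw [indExp_apply]
  split_ifs with h <;> simp [h, Nat.one_le_iff_ne_zero]

variable (K) in
/-- The squarefree monomial with a given support. -/
noncomputable def sqfMon (W : Finset V) : MvPolynomial V K := ∏ v ∈ W, X v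

theorem sqfMon_eq_monomial (W : Finset V) : sqfMon K W = monomial (indExp W) 1 := by
  rw [indExp, monomial_sum_one]; rfl

theorem sqfMon_ne_zero (W : Finset V) : sqfMon K W ≠ 0 :=
  Finset.prod_ne_zero_iff.2 fun v _ => X_ne_zero v

theorem sqfMon_union_of_disjoint [DecidableEq V] {W W' : Finset V} (h : Disjoint W W') :
    sqfMon K (W ∪ W') = sqfMon K W * sqfMon K W' := Finset.prod_union h

theorem sqfMon_dvd_sqfMon {W W' : Finset V} (h : W ⊆ W') : sqfMon K W ∣ sqfMon K W' :=
  Finset.prod_dvd_prod_of_subset _ _ _ h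

theorem monomial_one_dvd_iff (e : V →₀ ℕ) (p : MvPolynomial V K) :
    monomial e 1 ∣ p ↔ ∀ E, coeff E p ≠ 0 → e ≤ E := by
  have := mem_ideal_span_monomial_image (x := p) (s := {e})
  rw [Set.image_singleton, Ideal.mem_span_singleton] at this
  rw [this]; simp

theorem sqfMon_dvd_iff [DecidableEq V] (W : Finset V) (p : MvPolynomial V K) :
    sqfMon K W ∣ p ↔ ∀ E, coeff E p ≠ 0 → ∀ v ∈ W, E v ≠ 0 := by
  simp [sqfMon_eq_monomial, monomial_one_dvd_iff, indExp_le_iff]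

theorem mem_span_sqfMon_image_iff [DecidableEq V] {Λ : Type*} (A : Λ → Finset V) (G : Set Λ)
    (p : MvPolynomial V K) :
    p ∈ Ideal.span ((fun i => sqfMon K (A i)) '' G) ↔
      ∀ E, coeff E p ≠ 0 → ∃ i ∈ G, ∀ v ∈ A i, E v ≠ 0 := by
  have := mem_ideal_span_monomial_image (x := p) (s := (fun i => indExp (A i)) '' G)
  rw [Set.image_image] at this
  simp only [sqfMon_eq_monomial]
  rw [this]
  simp [indExp_le_iff]

/-- The `K`-linear endomorphism of the polynomial ring keeping the monomials whose exponent
lies in `C`. -/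
noncomputable def restrictExp (C : Set (V →₀ ℕ)) :
    MvPolynomial V K →ₗ[K] MvPolynomial V K :=
  open Classical in
  (basisMonomials V K).constr K fun E => if E ∈ C then monomial E 1 else 0

open Classical in
theorem coeff_restrictExp (C : Set (V →₀ ℕ)) (p : MvPolynomial V K) (E : V →₀ ℕ) :
    coeff E (restrictExp C p) = if E ∈ C then coeff E p else 0 := by
  induction p using MvPolynomial.induction_on' with
  | monomial e a =>
    have : (monomial e a : MvPolynomial V K) = a • basisMonomials V K e := by
      simp [smul_monomial]
    rw [this, map_smul, restrictExp, Module.Basis.constr_basis]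
    split_ifs <;> simp_all [coeff_monomial]
    all_goals aesop
  | add p q hp hq => rw [map_add, coeff_add, hp, hq]; split_ifs <;> simp

end SquarefreeMonomials

section Labels

variable {Λ : Type*} {V : Type*} [DecidableEq V]

/-- The support of the least common multiple of the generators indexed by `s`. -/
def lab (A : Λ → Finset V) (s : Finset Λ) : Finset V := s.biUnion A

theorem lab_mono (A : Λ → Finset V) {s t : Finset Λ} (h : s ⊆ t) : lab A s ⊆ lab A t :=
  Finset.biUnion_subset_biUnion_of_subset_left A h

theorem lab_insert [DecidableEq Λ] (A : Λ → Finset V) (i : Λ) (s : Finset Λ) :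
    lab A (insert i s) = A i ∪ lab A s := Finset.biUnion_insert

theorem subset_lab (A : Λ → Finset V) {i : Λ} {s : Finset Λ} (h : i ∈ s) : A i ⊆ lab A s :=
  Finset.subset_biUnion_of_mem A h

variable {K : Type*} [Field K]

variable (K) in
/-- The ideal generated by the squarefree monomials with supports `A i`, `i ∈ G`. -/
noncomputable def sqfIdeal (A : Λ → Finset V) (G : Finset Λ) : Ideal (MvPolynomial V K) :=
  Ideal.span ((fun i => sqfMon K (A i)) '' G)

theorem mem_sqfIdeal_iff (A : Λ → Finset V) (G : Finset Λ) (p : MvPolynomial V K) :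
    p ∈ sqfIdeal K A G ↔ ∀ E, coeff E p ≠ 0 → ∃ i ∈ G, ∀ v ∈ A i, E v ≠ 0 :=
  mem_span_sqfMon_image_iff A G p

theorem mem_sqfIdeal_of_dvd (A : Λ → Finset V) (G : Finset Λ) {i : Λ} (hi : i ∈ G)
    {t : Finset Λ} (hit : i ∈ t) {p : MvPolynomial V K} (h : sqfMon K (lab A t) ∣ p) :
    p ∈ sqfIdeal K A G :=
  Ideal.mem_of_dvd _ ((sqfMon_dvd_sqfMon (subset_lab A hit)).trans h)
    (Ideal.subset_span ⟨i, hi, rfl⟩)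

end Labels

section Taylor

variable {Λ : Type} [LinearOrder Λ] {V : Type} [DecidableEq V] {K : Type u} [Field K]

variable (K) in
/-- The degree `k` part of the Taylor complex on the squarefree monomials with supports
`A i`, `i ∈ G`; an element of the free module with basis the faces `t` is recorded by its
coefficients, multiplied by the monomial of `t`. -/
noncomputable def taylor (A : Λ → Finset V) (G : Finset Λ) (k : ℕ) :
    Submodule (MvPolynomial V K) (Finset Λ → MvPolynomial V K) where
  carrier := {f | ∀ t, sqfMon K (lab A t) ∣ f t ∧ (t ∉ G.powersetCard k → f t = 0)}
  add_mem' ha hb t := ⟨dvd_add (ha t).1 (hb t).1, fun h => by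
    simp [(ha t).2 h, (hb t).2 h]⟩
  zero_mem' t := by simp
  smul_mem' c f hf t := ⟨(hf t).1.mul_left c, fun h => by simp [(hf t).2 h]⟩

theorem bdry_mem_taylor {A : Λ → Finset V} {G : Finset Λ} {k : ℕ}
    {f : Finset Λ → MvPolynomial V K} (hf : f ∈ taylor K A G (k + 1)) :
    bdry G f ∈ taylor K A G k := by
  intro t
  refine ⟨Finset.dvd_sum fun i _ => dvd_smul_of_dvd _ ((sqfMon_dvd_sqfMon (lab_mono A
    (Finset.subset_insert i t))).trans (hf _).1), fun ht => Finset.sum_eq_zero fun i hi => ?_⟩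
  rw [(hf _).2, smul_zero]
  contrapose! ht
  rw [Finset.mem_powersetCard] at ht ⊢
  rw [Finset.card_insert_of_notMem (Finset.mem_sdiff.1 hi).2] at ht
  exact ⟨(Finset.subset_insert _ _).trans ht.1, by omega⟩

theorem exists_bdry_eq {A : Λ → Finset V} {G : Finset Λ} {k : ℕ}
    {f : Finset Λ → MvPolynomial V K} (hf : f ∈ taylor K A G k)
    (hI : ∀ t, f t ∈ sqfIdeal K A G) (hd : bdry G f = 0) :
    ∃ g ∈ taylor K A G (k + 1), bdry G g = f := by
  classical
  let P : (V →₀ ℕ) → Λ → Prop := fun E i => i ∈ G ∧ ∀ v ∈ A i, E v ≠ 0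
  let c : (V →₀ ℕ) → Option Λ := fun E => if h : ∃ i, P E i then some h.choose else none
  have hc : ∀ E i, c E = some i → P E i := fun E i h => by
    by_cases hE : ∃ i, P E i
    · simp only [c, hE, dite_true, Option.some.injEq] at h
      exact h ▸ hE.choose_spec
    · simp [c, hE] at h
  have hc' : ∀ E, (∃ i, P E i) → ∃ i, c E = some i := fun E h => ⟨h.choose, by simp [c, h]⟩
  let π : Λ → MvPolynomial V K →ₗ[K] MvPolynomial V K := fun i => restrictExp {E | c E = some i}
  have hπ : ∀ i E p, coeff E (π i p) = if c E = some i then coeff E p else 0 := fun i E p => by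
    simp [π, coeff_restrictExp]
  have hsum : ∀ p ∈ sqfIdeal K A G, ∑ i ∈ G, π i p = p := fun p hp => by
    ext E
    rw [coeff_sum]
    simp only [hπ]
    by_cases hE : coeff E p = 0
    · simp [hE]
    obtain ⟨j, hj⟩ := hc' E ((mem_sqfIdeal_iff A G p).1 hp E hE)
    rw [Finset.sum_eq_single_of_mem j (hc E j hj).1]
    · simp [hj]
    · intro b _ hb
      simp [hj, hb.symm]
  have hdvd : ∀ t, ∀ i ∈ t, sqfMon K (lab A t) ∣ π i (f (t.erase i)) := fun t i hi => by
    rw [sqfMon_dvd_iff]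
    intro E hE v hv
    rw [hπ] at hE
    obtain ⟨hE1, hE2⟩ := ite_ne_right_iff.1 hE
    rw [← Finset.insert_erase hi, lab_insert, Finset.mem_union] at hv
    rcases hv with hv | hv
    · exact (hc E i hE1).2 v hv
    · exact (sqfMon_dvd_iff _ _).1 (hf (t.erase i)).1 E hE2 v hv
  let g : Finset Λ → MvPolynomial V K := fun t =>
    if t ∈ G.powersetCard (k + 1) then ∑ i ∈ t, faceSign i t • π i (f (t.erase i)) else 0
  refine ⟨g, fun t => ⟨?_, fun ht => if_neg ht⟩, ?_⟩
  · by_cases ht : t ∈ G.powersetCard (k + 1)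
    · simp only [g, ht, if_true]
      exact Finset.dvd_sum fun i hi => dvd_smul_of_dvd _ (hdvd t i hi)
    · simp only [g, ht, if_false, dvd_zero]
  · funext t
    by_cases ht : t ∈ G.powersetCard k
    · have htG := (Finset.mem_powersetCard.1 ht).1
      have h := bdry_cobdry_homotopy G (fun i => (π i).toAddMonoidHom)
        (fun _ => AddMonoidHom.id _) (fun _ _ _ => rfl) f htG
      simp only [AddMonoidHom.id_apply, LinearMap.toAddMonoidHom_coe] at h
      rw [hsum _ (hI t), Finset.sum_eq_zero (s := t), add_zero] at h
      · rw [← h]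
        refine Finset.sum_congr rfl fun j hj => ?_
        have : insert j t ∈ G.powersetCard (k + 1) := by
          rw [Finset.mem_sdiff] at hj
          rw [Finset.mem_powersetCard] at ht ⊢
          exact ⟨Finset.insert_subset hj.1 ht.1, by
            rw [Finset.card_insert_of_notMem hj.2, ht.2]⟩
        simp only [g, this, if_true]
      · intro i _
        have : ∑ j ∈ G \ t.erase i, faceSign j (t.erase i) • f (insert j (t.erase i)) = 0 :=
          congrFun hd (t.erase i)
        rw [this, map_zero, smul_zero]
    · rw [(hf t).2 ht]
      refine Finset.sum_eq_zero fun j hj => ?_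
      have : insert j t ∉ G.powersetCard (k + 1) := fun h => ht <| by
        rw [Finset.mem_powersetCard] at h ⊢
        rw [Finset.card_insert_of_notMem (Finset.mem_sdiff.1 hj).2] at h
        exact ⟨(Finset.subset_insert _ _).trans h.1, by omega⟩
      simp only [g, this, if_false, smul_zero]

variable (K) in
/-- The differential of the Taylor complex. -/
noncomputable def taylorD (A : Λ → Finset V) (G : Finset Λ) (k : ℕ) :
    taylor K A G (k + 1) →ₗ[MvPolynomial V K] taylor K A G k where
  toFun f := ⟨bdry G f.1, bdry_mem_taylor f.2⟩
  map_add' f g := by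
    ext1; funext t; simp [bdry, Finset.sum_add_distrib]
  map_smul' c f := by
    ext1; funext t
    simp only [bdry, SetLike.val_smul, Pi.smul_apply, RingHom.id_apply, Finset.smul_sum]
    exact Finset.sum_congr rfl fun i _ => smul_comm _ _ _

variable (K) in
/-- The augmentation of the Taylor complex. -/
noncomputable def taylorπ (A : Λ → Finset V) (G : Finset Λ) :
    taylor K A G 0 →ₗ[MvPolynomial V K] MvPolynomial V K ⧸ sqfIdeal K A G :=
  (sqfIdeal K A G).mkQ ∘ₗ LinearMap.proj ∅ ∘ₗ (taylor K A G 0).subtype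

theorem taylorπ_surjective (A : Λ → Finset V) (G : Finset Λ) :
    Function.Surjective (taylorπ K A G) := by
  intro x
  obtain ⟨p, rfl⟩ := Submodule.mkQ_surjective _ x
  refine ⟨⟨Pi.single ∅ p, fun t => ?_⟩, by simp [taylorπ]⟩
  by_cases ht : t = ∅
  · subst ht; simp [sqfMon, lab]
  · simp [ht]

theorem taylorD_exact_zero (A : Λ → Finset V) (G : Finset Λ) :
    Function.Exact (taylorD K A G 0) (taylorπ K A G) := by
  intro f
  have hπ : taylorπ K A G f = 0 ↔ f.1 ∅ ∈ sqfIdeal K A G := by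
    simp [taylorπ, Ideal.Quotient.eq_zero_iff_mem]
  rw [hπ]
  constructor
  · intro h
    obtain ⟨g, hg, hgf⟩ := exists_bdry_eq f.2 (fun t => by
      by_cases ht : t ∈ G.powersetCard 0
      · rw [Finset.powersetCard_zero, Finset.mem_singleton] at ht
        exact ht ▸ h
      · rw [(f.2 t).2 ht]; exact zero_mem _) (by
      funext t
      refine Finset.sum_eq_zero fun i _ => ?_
      rw [(f.2 _).2 (by simp), smul_zero])
    exact ⟨⟨g, hg⟩, Subtype.ext hgf⟩
  · rintro ⟨g, rfl⟩
    refine Ideal.sum_mem _ fun i hi => zsmul_mem ?_ _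
    exact mem_sqfIdeal_of_dvd A G (Finset.mem_sdiff.1 hi).1 (Finset.mem_insert_self i ∅) (g.2 _).1

theorem taylorD_exact (A : Λ → Finset V) (G : Finset Λ) (k : ℕ) :
    Function.Exact (taylorD K A G (k + 1)) (taylorD K A G k) := by
  intro f
  constructor
  · intro h
    obtain ⟨g, hg, hgf⟩ := exists_bdry_eq f.2 (fun t => by
      by_cases ht : t ∈ G.powersetCard (k + 1)
      · rw [Finset.mem_powersetCard] at ht
        obtain ⟨i, hi⟩ := Finset.card_pos.1 (by omega : 0 < t.card)
        exact mem_sqfIdeal_of_dvd A G (ht.1 hi) hi (f.2 t).1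
      · rw [(f.2 t).2 ht]; exact zero_mem _) (congrArg Subtype.val h)
    exact ⟨⟨g, hg⟩, Subtype.ext hgf⟩
  · rintro ⟨g, rfl⟩
    exact Subtype.ext (funext fun t => bdry_bdry G g.1 t)

variable (K) in
/-- The element of the Taylor complex with prescribed coordinates. -/
noncomputable def taylorOfCoords (A : Λ → Finset V) (G : Finset Λ) (k : ℕ) :
    (G.powersetCard k → MvPolynomial V K) →ₗ[MvPolynomial V K] taylor K A G k where
  toFun f := ⟨fun t => if h : t ∈ G.powersetCard k then sqfMon K (lab A t) * f ⟨t, h⟩ else 0,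
    fun t => ⟨by dsimp only; split_ifs <;> simp, fun h => dif_neg h⟩⟩
  map_add' f g := by
    ext1; funext t
    by_cases h : t ∈ G.powersetCard k <;> simp only [h, dite_true, dite_false, Pi.add_apply,
      Submodule.coe_add, mul_add, add_zero]
  map_smul' c f := by
    ext1; funext t
    by_cases h : t ∈ G.powersetCard k <;> simp only [h, dite_true, dite_false, Pi.smul_apply,
      Submodule.coe_smul, smul_eq_mul, RingHom.id_apply, mul_zero, mul_left_comm]

theorem taylorOfCoords_apply (A : Λ → Finset V) (G : Finset Λ) (k : ℕ)
    (f : G.powersetCard k → MvPolynomial V K) (t : G.powersetCard k) :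
    (taylorOfCoords K A G k f).1 t = sqfMon K (lab A t) * f t := dif_pos t.2

variable (K) in
/-- The coordinates of an element of the Taylor complex with respect to its basis of faces. -/
noncomputable def taylorEquiv (A : Λ → Finset V) (G : Finset Λ) (k : ℕ) :
    (G.powersetCard k → MvPolynomial V K) ≃ₗ[MvPolynomial V K] taylor K A G k := by
  refine LinearEquiv.ofBijective (taylorOfCoords K A G k) ⟨fun f g h => ?_, fun f => ?_⟩
  · funext t
    have := congrFun (congrArg Subtype.val h) t
    rw [taylorOfCoords_apply, taylorOfCoords_apply] at this
    exact mul_left_cancel₀ (sqfMon_ne_zero _) this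
  · choose q hq using fun t => (f.2 t).1
    refine ⟨fun t => q t, ?_⟩
    ext1; funext t
    by_cases h : t ∈ G.powersetCard k
    · rw [taylorOfCoords_apply A G k _ ⟨t, h⟩, ← hq]
    · rw [(f.2 t).2 h, ((taylorOfCoords K A G k _).2 t).2 h]

instance (A : Λ → Finset V) (G : Finset Λ) (k : ℕ) :
    Module.Projective (MvPolynomial V K) (taylor K A G k) :=
  Module.Projective.of_equiv (taylorEquiv K A G k)

variable (K) in
/-- The generator of the Taylor complex attached to the face `t`. -/
noncomputable def taylorGen (A : Λ → Finset V) (G : Finset Λ) (k : ℕ) (t : Finset Λ) :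
    taylor K A G k :=
  ⟨Pi.single t (if t ∈ G.powersetCard k then sqfMon K (lab A t) else 0), fun s => by
    by_cases hs : s = t
    · subst hs; rw [Pi.single_eq_same]
      split_ifs with h <;> simp [h]
    · simp [hs]⟩

theorem taylorGen_apply {A : Λ → Finset V} {G : Finset Λ} {k : ℕ} {t : Finset Λ}
    (ht : t ∈ G.powersetCard k) (u : Finset Λ) :
    (taylorGen K A G k t).1 u = if u = t then sqfMon K (lab A t) else 0 := by
  simp only [taylorGen, ht, if_true, Pi.single_apply]

theorem taylorEquiv_single (A : Λ → Finset V) (G : Finset Λ) (k : ℕ) (t : G.powersetCard k) :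
    taylorEquiv K A G k (Pi.single t 1) = taylorGen K A G k t := by
  ext1; funext s
  by_cases h : s ∈ G.powersetCard k
  · refine (taylorOfCoords_apply A G k _ ⟨s, h⟩).trans ?_
    by_cases hs : s = t
    · subst hs
      simp only [taylorGen, Pi.single_eq_same, mul_one, h, if_true]
    · have : (⟨s, h⟩ : G.powersetCard k) ≠ t := fun h => hs (congrArg Subtype.val h)
      simp only [taylorGen, Pi.single_eq_of_ne hs, Pi.single_eq_of_ne this, mul_zero]
  · rw [((taylorGen K A G k t).2 s).2 h, ((taylorEquiv K A G k _).2 s).2 h]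

theorem taylor_hom_ext {A : Λ → Finset V} {G : Finset Λ} {k : ℕ} {M : Type*} [AddCommGroup M]
    [Module (MvPolynomial V K) M] {φ ψ : taylor K A G k →ₗ[MvPolynomial V K] M}
    (h : ∀ t ∈ G.powersetCard k, φ (taylorGen K A G k t) = ψ (taylorGen K A G k t)) : φ = ψ := by
  have : φ ∘ₗ (taylorEquiv K A G k).toLinearMap = ψ ∘ₗ (taylorEquiv K A G k).toLinearMap := by
    refine LinearMap.pi_ext' fun t => LinearMap.ext_ring ?_
    simpa [taylorEquiv_single] using h t t.2
  ext x
  obtain ⟨y, rfl⟩ := (taylorEquiv K A G k).surjective x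
  exact LinearMap.congr_fun this y

variable (K) in
/-- The linear form on the Taylor complex with prescribed values on the generators. -/
noncomputable def taylorLift (A : Λ → Finset V) (G : Finset Λ) (k : ℕ)
    (q : Finset Λ → MvPolynomial V K) : taylor K A G k →ₗ[MvPolynomial V K] MvPolynomial V K :=
  (LinearMap.lsum _ _ ℕ fun t : G.powersetCard k => LinearMap.mulRight _ (q t)) ∘ₗ
    (taylorEquiv K A G k).symm.toLinearMap

theorem taylorLift_gen (A : Λ → Finset V) (G : Finset Λ) (k : ℕ)
    (q : Finset Λ → MvPolynomial V K) (t : Finset Λ) (ht : t ∈ G.powersetCard k) :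
    taylorLift K A G k q (taylorGen K A G k t) = q t := by
  rw [taylorLift, ← taylorEquiv_single A G k ⟨t, ht⟩]
  simp [LinearMap.lsum_apply, Pi.single_apply]

variable [Fintype V]

theorem sqfMon_smul_taylorD_gen (A : Λ → Finset V) (G : Finset Λ) (k : ℕ) {s : Finset Λ}
    (hs : s ∈ G.powersetCard (k + 1)) :
    sqfMon K (Finset.univ \ lab A s) • taylorD K A G k (taylorGen K A G (k + 1) s) =
      ∑ i ∈ s, faceSign i s • sqfMon K (Finset.univ \ lab A (s.erase i)) •
        taylorGen K A G k (s.erase i) := by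
  have hu : ∀ t : Finset Λ, sqfMon K (Finset.univ \ lab A t) * sqfMon K (lab A t) =
      sqfMon K Finset.univ := fun t => by
    rw [← sqfMon_union_of_disjoint Finset.sdiff_disjoint,
      Finset.sdiff_union_of_subset (Finset.subset_univ _)]
  have he : ∀ i ∈ s, s.erase i ∈ G.powersetCard k := fun i hi => by
    rw [Finset.mem_powersetCard] at hs ⊢
    exact ⟨(Finset.erase_subset _ _).trans hs.1, by
      rw [Finset.card_erase_of_mem hi, hs.2]; rfl⟩
  ext1; funext u
  have hL : (sqfMon K (Finset.univ \ lab A s) • taylorD K A G k (taylorGen K A G (k + 1) s)).1 u =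
      ∑ i ∈ G \ u, faceSign i u • if insert i u = s then sqfMon K Finset.univ else 0 := by
    change sqfMon K (Finset.univ \ lab A s) • bdry G (taylorGen K A G (k + 1) s).1 u = _
    rw [bdry, Finset.smul_sum]
    refine Finset.sum_congr rfl fun i _ => ?_
    rw [smul_comm, taylorGen_apply hs]
    split_ifs
    · rw [smul_eq_mul, hu]
    · simp
  have hR : (∑ i ∈ s, faceSign i s • sqfMon K (Finset.univ \ lab A (s.erase i)) •
        taylorGen K A G k (s.erase i)).1 u =
      ∑ i ∈ s, faceSign i s • if s.erase i = u then sqfMon K Finset.univ else 0 := by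
    rw [Submodule.coe_sum, Finset.sum_apply]
    refine Finset.sum_congr rfl fun i hi => ?_
    change faceSign i s • sqfMon K (Finset.univ \ lab A (s.erase i)) •
      (taylorGen K A G k (s.erase i)).1 u = _
    rw [taylorGen_apply (he i hi)]
    split_ifs with h1 h2 h2
    · rw [smul_eq_mul, hu]
    · exact absurd h1.symm h2
    · exact absurd h2.symm h1
    · simp
  rw [hL, hR]
  by_cases hu : ∃ i ∈ s, s.erase i = u
  · obtain ⟨i, hi, rfl⟩ := hu
    have hiG := (Finset.mem_powersetCard.1 hs).1 hi
    rw [Finset.sum_eq_single_of_mem i hi, Finset.sum_eq_single_of_mem i (by simp [hiG])]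
    · rw [Finset.insert_erase hi, faceSign_erase_self, if_pos rfl, if_pos rfl]
    · intro j _ hj
      rw [if_neg, smul_zero]
      intro h
      have : j ∈ s.erase i := Finset.mem_erase.2 ⟨hj, h ▸ Finset.mem_insert_self _ _⟩
      rw [Finset.insert_eq_of_mem this] at h
      exact Finset.notMem_erase i s (h.symm ▸ hi)
    · intro j hj hji
      rw [if_neg, smul_zero]
      intro h
      exact Finset.notMem_erase j s (h ▸ Finset.mem_erase.2 ⟨hji, hj⟩)
  · push Not at hu
    rw [Finset.sum_eq_zero, Finset.sum_eq_zero]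
    · intro i hi
      rw [if_neg (hu i hi), smul_zero]
    · intro i hi
      rw [if_neg, smul_zero]
      intro h
      refine hu i (h ▸ Finset.mem_insert_self _ _) ?_
      rw [← h, Finset.erase_insert (Finset.mem_sdiff.1 hi).2]

/-- The cochain of a linear form on the Taylor complex, homogenized so that the transpose of
the Taylor differential becomes the simplicial coboundary. -/
noncomputable def taylorHat {A : Λ → Finset V} {G : Finset Λ} {k : ℕ}
    (φ : taylor K A G k →ₗ[MvPolynomial V K] MvPolynomial V K) (t : Finset Λ) :
    MvPolynomial V K :=
  sqfMon K (Finset.univ \ lab A t) * φ (taylorGen K A G k t)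

theorem taylorHat_comp_taylorD {A : Λ → Finset V} {G : Finset Λ} {k : ℕ}
    (φ : taylor K A G k →ₗ[MvPolynomial V K] MvPolynomial V K) {s : Finset Λ}
    (hs : s ∈ G.powersetCard (k + 1)) :
    taylorHat (φ ∘ₗ taylorD K A G k) s = cobdry (taylorHat φ) s := by
  have h := congrArg φ (sqfMon_smul_taylorD_gen A G k hs (K := K))
  rw [map_smul, map_sum] at h
  rw [taylorHat, LinearMap.comp_apply, ← smul_eq_mul, h]
  refine Finset.sum_congr rfl fun i _ => ?_
  rw [map_zsmul, map_smul, taylorHat, smul_eq_mul]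

theorem eq_of_taylorHat_eq {A : Λ → Finset V} {G : Finset Λ} {k : ℕ}
    {φ ψ : taylor K A G k →ₗ[MvPolynomial V K] MvPolynomial V K}
    (h : ∀ t ∈ G.powersetCard k, taylorHat φ t = taylorHat ψ t) : φ = ψ :=
  taylor_hom_ext fun t ht => mul_left_cancel₀ (sqfMon_ne_zero _) (h t ht)

end Taylor

section Strands

variable {Λ : Type} [LinearOrder Λ] {V : Type} [DecidableEq V] {K : Type u} [Field K]

/-- A cochain of degree `k` on the simplex with vertex set `G`, supported on the faces `t` with
`W ⊆ lab A t`. -/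
def IsStrand (A : Λ → Finset V) (G : Finset Λ) (k : ℕ) (W : Finset V) (z : Finset Λ → K) : Prop :=
  ∀ t, z t ≠ 0 → t ∈ G.powersetCard k ∧ W ⊆ lab A t

/-- The degree `k` cochain `z` on the simplex with vertex set `G` is the coboundary of a
cochain supported on the faces `t` with `W ⊆ lab A t`. -/
def IsStrandBdry (A : Λ → Finset V) (G : Finset Λ) (k : ℕ) (W : Finset V) (z : Finset Λ → K) :
    Prop :=
  ∃ y : Finset Λ → K, (∀ t, y t ≠ 0 → W ⊆ lab A t) ∧ ∀ s ∈ G.powersetCard k, cobdry y s = z s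

variable (K) in
/-- The cohomology in degree `k` of the cochains supported on the faces `t` with
`W ⊆ lab A t` does not vanish. -/
def StrandNonexact (A : Λ → Finset V) (G : Finset Λ) (k : ℕ) (W : Finset V) : Prop :=
  ∃ z : Finset Λ → K, IsStrand A G k W z ∧ (∀ s ∈ G.powersetCard (k + 1), cobdry z s = 0) ∧
    ¬ IsStrandBdry A G k W z

theorem erase_mem_powersetCard {G s : Finset Λ} {k : ℕ} (hs : s ∈ G.powersetCard (k + 1))
    {i : Λ} (hi : i ∈ s) : s.erase i ∈ G.powersetCard k := by
  rw [Finset.mem_powersetCard] at hs ⊢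
  exact ⟨(Finset.erase_subset _ _).trans hs.1, by rw [Finset.card_erase_of_mem hi, hs.2]; rfl⟩

theorem hasProjectiveDimensionLT_card_add_one (A : Λ → Finset V) (G : Finset Λ) :
    HasProjectiveDimensionLT (ModuleCat.of (MvPolynomial V K)
      (MvPolynomial V K ⧸ sqfIdeal K A G)) (G.card + 1) := by
  refine hasProjectiveDimensionLT_of_retraction G.card (fun i => taylor K A G i)
    (taylorD K A G) (taylorπ K A G) (taylorπ_surjective A G) (taylorD_exact_zero A G)
    (taylorD_exact A G) 0 ?_
  rintro ⟨_, x, rfl⟩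
  have hx : x = 0 := Subtype.ext <| funext fun t => (x.2 t).2 fun ht => by
    rw [Finset.mem_powersetCard] at ht
    have := Finset.card_le_card ht.1
    omega
  subst hx
  exact Subtype.ext (map_zero (taylorD K A G G.card)).symm

variable [Fintype V]

theorem subset_lab_of_coeff_taylorHat_ne_zero {A : Λ → Finset V} {G : Finset Λ} {k : ℕ}
    {φ : taylor K A G k →ₗ[MvPolynomial V K] MvPolynomial V K} {t : Finset Λ} {E : V →₀ ℕ}
    (h : coeff E (taylorHat φ t) ≠ 0) {v : V} (hv : E v = 0) : v ∈ lab A t := by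
  by_contra hvt
  exact (sqfMon_dvd_iff _ _).1 (Dvd.intro _ rfl) E h v (by simp [hvt]) hv

theorem exists_comp_taylorD_eq {A : Λ → Finset V} {G : Finset Λ} {k : ℕ}
    (hex : ∀ W, ¬ StrandNonexact K A G (k + 1) W)
    (φ : taylor K A G (k + 1) →ₗ[MvPolynomial V K] MvPolynomial V K)
    (hφ : φ ∘ₗ taylorD K A G (k + 1) = 0) : ∃ ψ, ψ ∘ₗ taylorD K A G k = φ := by
  classical
  have hy : ∀ E : V →₀ ℕ, ∃ y : Finset Λ → K,
      (∀ t, y t ≠ 0 → Finset.univ.filter (fun v => E v = 0) ⊆ lab A t) ∧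
      ∀ s ∈ G.powersetCard (k + 1), cobdry y s = coeff E (taylorHat φ s) := fun E => by
    by_contra hno
    refine hex (Finset.univ.filter fun v => E v = 0)
      ⟨fun t => if t ∈ G.powersetCard (k + 1) then coeff E (taylorHat φ t) else 0,
        fun t ht => ?_, fun s hs => ?_, ?_⟩
    · obtain ⟨h1, h2⟩ := ite_ne_right_iff.1 ht
      exact ⟨h1, fun v hv => subset_lab_of_coeff_taylorHat_ne_zero h2
        (Finset.mem_filter.1 hv).2⟩
    · have h := congrArg (coeffAddMonoidHom E) (taylorHat_comp_taylorD φ hs)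
      rw [hφ, map_cobdry] at h
      rw [cobdry_congr (g := fun t => coeffAddMonoidHom E (taylorHat φ t)), ← h]
      · simp [taylorHat]
      · intro i hi
        rw [if_pos (erase_mem_powersetCard hs hi)]; rfl
    · rintro ⟨y, hy1, hy2⟩
      exact hno ⟨y, hy1, fun s hs => (hy2 s hs).trans (if_pos hs)⟩
  choose y hyW hyz using hy
  let F : Finset (V →₀ ℕ) := (G.powersetCard (k + 1)).biUnion fun t => (taylorHat φ t).support
  let b : Finset Λ → MvPolynomial V K := fun t => ∑ E ∈ F, monomial E (y E t)
  have hb : ∀ E t, coeff E (b t) = if E ∈ F then y E t else 0 := fun E t => by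
    simp [b, coeff_sum, coeff_monomial]
  have hdvd : ∀ t, sqfMon K (Finset.univ \ lab A t) ∣ b t := fun t => by
    rw [sqfMon_dvd_iff]
    intro E hE v hv hEv
    rw [hb] at hE
    exact (Finset.mem_sdiff.1 hv).2
      (hyW E t (ite_ne_right_iff.1 hE).2 (Finset.mem_filter.2 ⟨Finset.mem_univ v, hEv⟩))
  choose q hq using hdvd
  refine ⟨taylorLift K A G k q, eq_of_taylorHat_eq fun s hs => ?_⟩
  rw [taylorHat_comp_taylorD _ hs, cobdry_congr (g := b)]
  · ext E
    change coeffAddMonoidHom E _ = _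
    rw [map_cobdry, cobdry_congr (g := fun t => if E ∈ F then y E t else 0) fun i _ => hb E _]
    by_cases hE : E ∈ F
    · simp only [hE, if_true]
      exact hyz E s hs
    · simp only [hE, if_false]
      simp only [F, Finset.mem_biUnion, not_exists, not_and, mem_support_iff, not_not] at hE
      rw [hE s hs]
      simp [cobdry]
  · intro i hi
    rw [taylorHat, taylorLift_gen _ _ _ _ _ (erase_mem_powersetCard hs hi), ← hq]

theorem exists_strandNonexact_of_hasProjectiveDimensionLT {A : Λ → Finset V} {G : Finset Λ}
    {k : ℕ}
    (h : HasProjectiveDimensionLT (ModuleCat.of (MvPolynomial V K)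
      (MvPolynomial V K ⧸ sqfIdeal K A G)) (k + 2))
    (h' : ¬ HasProjectiveDimensionLT (ModuleCat.of (MvPolynomial V K)
      (MvPolynomial V K ⧸ sqfIdeal K A G)) (k + 1)) :
    ∃ W, StrandNonexact K A G (k + 1) W := by
  by_contra! hex
  refine h' ?_
  have := projective_range_of_hasProjectiveDimensionLT k (fun i => taylor K A G i)
    (taylorD K A G) (taylorπ K A G) (taylorπ_surjective A G) (taylorD_exact_zero A G)
    (taylorD_exact A G) h
  obtain ⟨σ, hσ⟩ := Module.projective_lifting_property (taylorD K A G k).rangeRestrict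
    LinearMap.id (LinearMap.surjective_rangeRestrict _)
  have hext : ∀ j : G.powersetCard (k + 1), ∃ ψ, ψ ∘ₗ taylorD K A G k =
      LinearMap.proj j ∘ₗ (taylorEquiv K A G (k + 1)).symm.toLinearMap ∘ₗ σ ∘ₗ
        (taylorD K A G k).rangeRestrict := fun j =>
    exists_comp_taylorD_eq hex _ <| by
      have : (taylorD K A G k).rangeRestrict ∘ₗ taylorD K A G (k + 1) = 0 := by
        ext1 x
        exact Subtype.ext ((taylorD_exact A G k).apply_apply_eq_zero x)
      rw [LinearMap.comp_assoc, LinearMap.comp_assoc, LinearMap.comp_assoc, this]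
      simp
  choose ψ hψ using hext
  refine hasProjectiveDimensionLT_of_retraction k (fun i => taylor K A G i)
    (taylorD K A G) (taylorπ K A G) (taylorπ_surjective A G) (taylorD_exact_zero A G)
    (taylorD_exact A G) ((taylorD K A G k).rangeRestrict ∘ₗ
      (taylorEquiv K A G (k + 1)).toLinearMap ∘ₗ LinearMap.pi ψ) ?_
  rintro ⟨_, x, rfl⟩
  have hx : (taylorEquiv K A G (k + 1)) (LinearMap.pi ψ (taylorD K A G k x)) =
      σ ((taylorD K A G k).rangeRestrict x) := by
    rw [← LinearEquiv.eq_symm_apply]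
    funext j
    exact LinearMap.congr_fun (hψ j) x
  change (taylorD K A G k).rangeRestrict
    (taylorEquiv K A G (k + 1) (LinearMap.pi ψ (taylorD K A G k x))) = _
  rw [hx]
  exact LinearMap.congr_fun hσ _

theorem StrandNonexact.not_hasProjectiveDimensionLT {A : Λ → Finset V} {G : Finset Λ} {k : ℕ}
    {W : Finset V} (hW : StrandNonexact K A G (k + 1) W) :
    ¬ HasProjectiveDimensionLT (ModuleCat.of (MvPolynomial V K)
      (MvPolynomial V K ⧸ sqfIdeal K A G)) (k + 1) := by
  intro h
  obtain ⟨z, hz, hcoc, hbd⟩ := hW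
  obtain ⟨ρ, hρ⟩ := exists_retraction_of_hasProjectiveDimensionLT k (fun i => taylor K A G i)
    (taylorD K A G) (taylorπ K A G) (taylorπ_surjective A G) (taylorD_exact_zero A G)
    (taylorD_exact A G) h
  let φ := taylorLift K A G (k + 1) fun t => C (z t) * sqfMon K (lab A t \ W)
  have hφ : ∀ t ∈ G.powersetCard (k + 1),
      taylorHat φ t = C (z t) * sqfMon K (Finset.univ \ W) := fun t ht => by
    rw [taylorHat, taylorLift_gen _ _ _ _ _ ht]
    by_cases hzt : z t = 0
    · simp [hzt]
    rw [mul_left_comm, ← sqfMon_union_of_disjoint]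
    · congr 2
      have := (hz t hzt).2
      ext v
      simp only [Finset.mem_union, Finset.mem_sdiff, Finset.mem_univ, true_and]
      constructor
      · rintro (h | h)
        · exact fun hv => h (this hv)
        · exact h.2
      · intro h
        by_cases hv : v ∈ lab A t
        · exact Or.inr ⟨hv, h⟩
        · exact Or.inl hv
    · exact Finset.disjoint_left.2 fun v h1 h2 =>
        (Finset.mem_sdiff.1 h1).2 (Finset.mem_sdiff.1 h2).1
  have hφd : φ ∘ₗ taylorD K A G (k + 1) = 0 := eq_of_taylorHat_eq fun s hs => by
    rw [taylorHat_comp_taylorD _ hs, cobdry_congr (g := fun t => AddMonoidHom.mulRight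
      (sqfMon K (Finset.univ \ W)) (C (z t))) fun i hi => hφ _ (erase_mem_powersetCard hs hi),
      ← map_cobdry, ← map_cobdry, hcoc s hs]
    simp [taylorHat]
  have hker : LinearMap.ker (taylorD K A G k) ≤ LinearMap.ker φ := fun x hx => by
    obtain ⟨w, rfl⟩ := (taylorD_exact A G k x).1 hx
    exact LinearMap.congr_fun hφd w
  let φ' : LinearMap.range (taylorD K A G k) →ₗ[MvPolynomial V K] MvPolynomial V K :=
    (LinearMap.ker (taylorD K A G k)).liftQ φ hker ∘ₗ
      (taylorD K A G k).quotKerEquivRange.symm.toLinearMap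
  have hψ : (φ' ∘ₗ ρ) ∘ₗ taylorD K A G k = φ := by
    ext1 x
    have h1 : ρ (taylorD K A G k x) = ⟨taylorD K A G k x, x, rfl⟩ :=
      hρ ⟨taylorD K A G k x, x, rfl⟩
    rw [LinearMap.comp_apply, LinearMap.comp_apply, h1, LinearMap.comp_apply]
    have h2 : (taylorD K A G k).quotKerEquivRange.symm ⟨taylorD K A G k x, x, rfl⟩ =
        (LinearMap.ker (taylorD K A G k)).mkQ x := by
      rw [LinearEquiv.symm_apply_eq]
      rfl
    rw [LinearEquiv.coe_coe, h2]
    simp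
  refine hbd ⟨fun t => coeffAddMonoidHom (indExp (Finset.univ \ W)) (taylorHat (φ' ∘ₗ ρ) t),
    fun t ht v hv => subset_lab_of_coeff_taylorHat_ne_zero ht (by simp [indExp_apply, hv]),
    fun s hs => ?_⟩
  rw [← map_cobdry, ← taylorHat_comp_taylorD _ hs, hψ, hφ s hs, sqfMon_eq_monomial]
  simp [coeff_C_mul]

end Strands

section Join

variable {Λ : Type*} [LinearOrder Λ] {G₁ G₂ : Finset Λ}

theorem faceSign_of_mem_left (hlt : ∀ i ∈ G₁, ∀ j ∈ G₂, i < j) {s : Finset Λ}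
    (hs : s ⊆ G₁ ∪ G₂) {i : Λ} (hi : i ∈ G₁) : faceSign i s = faceSign i (s ∩ G₁) := by
  rw [faceSign, faceSign]
  congr 2
  ext j
  simp only [Finset.mem_filter, Finset.mem_inter]
  refine ⟨fun h => ⟨⟨h.1, ?_⟩, h.2⟩, fun h => ⟨h.1.1, h.2⟩⟩
  rcases Finset.mem_union.1 (hs h.1) with hj | hj
  · exact hj
  · exact absurd (hlt i hi j hj) h.2.not_gt

theorem faceSign_of_mem_right (hlt : ∀ i ∈ G₁, ∀ j ∈ G₂, i < j) {s : Finset Λ}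
    (hs : s ⊆ G₁ ∪ G₂) {i : Λ} (hi : i ∈ G₂) :
    faceSign i s = (-1) ^ (s ∩ G₁).card * faceSign i (s ∩ G₂) := by
  rw [faceSign, faceSign, ← pow_add, ← Finset.card_union_of_disjoint]
  · congr 2
    ext j
    simp only [Finset.mem_filter, Finset.mem_inter, Finset.mem_union]
    constructor
    · rintro ⟨h1, h2⟩
      rcases Finset.mem_union.1 (hs h1) with hj | hj
      · exact Or.inl ⟨h1, hj⟩
      · exact Or.inr ⟨⟨h1, hj⟩, h2⟩
    · rintro (h | h)
      · exact ⟨h.1, hlt j h.2 i hi⟩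
      · exact ⟨h.1.1, h.2⟩
  · refine Finset.disjoint_left.2 fun j h1 h2 => ?_
    simp only [Finset.mem_filter, Finset.mem_inter] at h1 h2
    exact lt_irrefl j (hlt j h1.2 j h2.1.2)

theorem erase_inter_of_notMem (s G : Finset Λ) {i : Λ} (hi : i ∉ G) :
    s.erase i ∩ G = s ∩ G := by
  rw [Finset.erase_inter, Finset.erase_eq_of_notMem (by simp [hi])]

/-- The coboundary of a cochain on a join. -/
theorem cobdry_inter_inter {M : Type*} [AddCommGroup M] (hlt : ∀ i ∈ G₁, ∀ j ∈ G₂, i < j)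
    (F : Finset Λ → Finset Λ → M) {s : Finset Λ} (hs : s ⊆ G₁ ∪ G₂) :
    cobdry (fun t => F (t ∩ G₁) (t ∩ G₂)) s =
      cobdry (fun t => F t (s ∩ G₂)) (s ∩ G₁) +
        (-1 : ℤ) ^ (s ∩ G₁).card • cobdry (fun t => F (s ∩ G₁) t) (s ∩ G₂) := by
  have hdisj : Disjoint G₁ G₂ :=
    Finset.disjoint_left.2 fun j h1 h2 => lt_irrefl j (hlt j h1 j h2)
  have hsplit : s = (s ∩ G₁) ∪ (s ∩ G₂) := by
    rw [← Finset.inter_union_distrib_left, Finset.inter_eq_left.2 hs]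
  have hd : Disjoint (s ∩ G₁) (s ∩ G₂) :=
    hdisj.mono Finset.inter_subset_right Finset.inter_subset_right
  have h1 : cobdry (fun t => F (t ∩ G₁) (t ∩ G₂)) s =
      ∑ i ∈ (s ∩ G₁) ∪ (s ∩ G₂), faceSign i s • F (s.erase i ∩ G₁) (s.erase i ∩ G₂) := by
    rw [← hsplit]; rfl
  rw [h1, Finset.sum_union hd, cobdry, cobdry, Finset.smul_sum]
  congr 1
  · refine Finset.sum_congr rfl fun i hi => ?_
    have hi1 := (Finset.mem_inter.1 hi).2
    rw [faceSign_of_mem_left hlt hs hi1,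
      erase_inter_of_notMem s G₂ (Finset.disjoint_left.1 hdisj hi1), Finset.erase_inter]
  · refine Finset.sum_congr rfl fun i hi => ?_
    have hi2 := (Finset.mem_inter.1 hi).2
    rw [faceSign_of_mem_right hlt hs hi2,
      erase_inter_of_notMem s G₁ (Finset.disjoint_right.1 hdisj hi2), Finset.erase_inter,
      mul_smul]

end Join

section Kuenneth

variable {Λ : Type} [LinearOrder Λ] {V : Type} [DecidableEq V] {K : Type u} [Field K]

theorem IsStrand.cobdry_eq_zero {A : Λ → Finset V} {G : Finset Λ} {k : ℕ} {W : Finset V}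
    {z : Finset Λ → K} (hz : IsStrand A G k W z)
    (hc : ∀ s ∈ G.powersetCard (k + 1), cobdry z s = 0) {s : Finset Λ} (hs : s ⊆ G) :
    cobdry z s = 0 := by
  by_cases hk : s.card = k + 1
  · exact hc s (Finset.mem_powersetCard.2 ⟨hs, hk⟩)
  · refine Finset.sum_eq_zero fun i hi => ?_
    have : z (s.erase i) = 0 := by
      by_contra hne
      have := (Finset.mem_powersetCard.1 (hz _ hne).1).2
      rw [← Finset.card_erase_add_one hi, this] at hk
      exact hk rfl
    rw [this, smul_zero]

theorem IsStrand.subset_lab_of_not_isStrandBdry {A : Λ → Finset V} {G : Finset Λ} {k : ℕ}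
    {W : Finset V} {z : Finset Λ → K} (hz : IsStrand A G k W z) (hb : ¬ IsStrandBdry A G k W z) :
    W ⊆ lab A G := by
  have : ∃ t, z t ≠ 0 := by
    by_contra! h
    exact hb ⟨0, fun t ht => absurd rfl ht, fun s _ => by simp [cobdry, h s]⟩
  obtain ⟨t, ht⟩ := this
  exact (hz t ht).2.trans (lab_mono A (Finset.mem_powersetCard.1 (hz t ht).1).1)

/-- The cochains whose restriction to the simplex with vertex set `G` is a coboundary. -/
def strandBdrySubmodule (K : Type u) [Field K] (A : Λ → Finset V) (G : Finset Λ) (k : ℕ)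
    (W : Finset V) : Submodule K (Finset Λ → K) where
  carrier := {z | IsStrandBdry A G k W z}
  zero_mem' := ⟨0, fun t ht => absurd rfl ht, fun s _ => by simp [cobdry]⟩
  add_mem' := by
    rintro a b ⟨y, hy, hy'⟩ ⟨w, hw, hw'⟩
    refine ⟨fun t => y t + w t, fun t ht => ?_, fun s hs => ?_⟩
    · by_cases h : y t = 0
      · exact hw t fun h' => ht (by simp [h, h'])
      · exact hy t h
    · rw [cobdry_add, hy' s hs, hw' s hs]; rfl
  smul_mem' := by
    rintro c a ⟨y, hy, hy'⟩
    refine ⟨fun t => c * y t, fun t ht => hy t (right_ne_zero_of_mul ht), fun s hs => ?_⟩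
    have := map_cobdry (AddMonoidHom.mulLeft c) y s
    rw [hy' s hs] at this
    exact this.symm

theorem StrandNonexact.join {A : Λ → Finset V} {G₁ G₂ : Finset Λ}
    (hlt : ∀ i ∈ G₁, ∀ j ∈ G₂, i < j) (hlab : Disjoint (lab A G₁) (lab A G₂)) {p₁ p₂ : ℕ}
    {W₁ W₂ : Finset V} (h₁ : StrandNonexact K A G₁ p₁ W₁) (h₂ : StrandNonexact K A G₂ p₂ W₂) :
    StrandNonexact K A (G₁ ∪ G₂) (p₁ + p₂) (W₁ ∪ W₂) := by
  obtain ⟨z₁, hz₁, hc₁, hb₁⟩ := h₁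
  obtain ⟨z₂, hz₂, hc₂, hb₂⟩ := h₂
  have hW₁ := hz₁.subset_lab_of_not_isStrandBdry hb₁
  have hW₂ := hz₂.subset_lab_of_not_isStrandBdry hb₂
  have hdisj : Disjoint G₁ G₂ :=
    Finset.disjoint_left.2 fun j h1 h2 => lt_irrefl j (hlt j h1 j h2)
  have hinter : ∀ {a b : Finset Λ}, a ⊆ G₁ → b ⊆ G₂ → (a ∪ b) ∩ G₁ = a ∧ (a ∪ b) ∩ G₂ = b :=
    fun {a b} ha hb => by
      rw [Finset.union_inter_distrib_right, Finset.union_inter_distrib_right,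
        Finset.inter_eq_left.2 ha, Finset.inter_eq_left.2 hb,
        Finset.disjoint_iff_inter_eq_empty.1 (hdisj.mono_left ha),
        Finset.disjoint_iff_inter_eq_empty.1 (hdisj.symm.mono_left hb)]
      simp
  have hsplit : ∀ {s : Finset Λ}, s ⊆ G₁ ∪ G₂ → (s ∩ G₁) ∪ (s ∩ G₂) = s := fun {s} hs => by
    rw [← Finset.inter_union_distrib_left, Finset.inter_eq_left.2 hs]
  refine ⟨fun s => if s ⊆ G₁ ∪ G₂ then z₁ (s ∩ G₁) * z₂ (s ∩ G₂) else 0, ?_, ?_, ?_⟩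
  · intro s hs
    obtain ⟨hs1, hs2⟩ := ite_ne_right_iff.1 hs
    have h1 := hz₁ _ (left_ne_zero_of_mul hs2)
    have h2 := hz₂ _ (right_ne_zero_of_mul hs2)
    refine ⟨Finset.mem_powersetCard.2 ⟨hs1, ?_⟩, Finset.union_subset
      (h1.2.trans (lab_mono A Finset.inter_subset_left))
      (h2.2.trans (lab_mono A Finset.inter_subset_left))⟩
    rw [← hsplit hs1, Finset.card_union_of_disjoint
      (hdisj.mono Finset.inter_subset_right Finset.inter_subset_right),
      (Finset.mem_powersetCard.1 h1.1).2, (Finset.mem_powersetCard.1 h2.1).2]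
  · intro s hs
    have hs := (Finset.mem_powersetCard.1 hs).1
    rw [cobdry_congr (g := fun t => z₁ (t ∩ G₁) * z₂ (t ∩ G₂)) fun i _ =>
      if_pos ((Finset.erase_subset _ _).trans hs),
      cobdry_inter_inter hlt (fun a b => z₁ a * z₂ b) hs]
    have e1 := map_cobdry (AddMonoidHom.mulRight (z₂ (s ∩ G₂))) z₁ (s ∩ G₁)
    have e2 := map_cobdry (AddMonoidHom.mulLeft (z₁ (s ∩ G₁))) z₂ (s ∩ G₂)
    rw [hz₁.cobdry_eq_zero hc₁ Finset.inter_subset_right, map_zero] at e1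
    rw [hz₂.cobdry_eq_zero hc₂ Finset.inter_subset_right, map_zero] at e2
    simp only [AddMonoidHom.coe_mulRight, AddMonoidHom.coe_mulLeft] at e1 e2
    rw [← e1, ← e2, smul_zero, add_zero]
  · rintro ⟨y, hy, hyz⟩
    obtain ⟨l, hl, hlB⟩ := Submodule.exists_le_ker_of_notMem
      (p := strandBdrySubmodule K A G₂ p₂ W₂) (v := z₂) hb₂
    have hlB' : ∀ f, IsStrandBdry A G₂ p₂ W₂ f → l f = 0 := fun f hf => hlB hf
    let y₁ : Finset Λ → K := fun t => if t ⊆ G₁ then (l z₂)⁻¹ * l fun b =>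
      if b ⊆ G₂ then y (t ∪ b) else 0 else 0
    refine hb₁ ⟨y₁, fun t ht => ?_, fun s hs => ?_⟩
    · obtain ⟨ht1, ht2⟩ := ite_ne_right_iff.1 ht
      contrapose! ht2
      refine mul_eq_zero_of_right _ (hlB' _ ?_)
      refine ⟨0, fun t ht => absurd rfl ht, fun b hb => ?_⟩
      have hb := (Finset.mem_powersetCard.1 hb).1
      have : y (t ∪ b) = 0 := by
        by_contra hne
        refine ht2 fun v hv => ?_
        have hv' := hy _ hne (Finset.mem_union_left _ hv)
        rw [lab, Finset.union_biUnion, Finset.mem_union] at hv'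
        exact hv'.resolve_right fun h =>
          Finset.disjoint_left.1 hlab (hW₁ hv) (lab_mono A hb h)
      simp [cobdry, hb, this]
    · obtain ⟨hsG, hsc⟩ := Finset.mem_powersetCard.1 hs
      have hy₁ : cobdry y₁ s = (l z₂)⁻¹ * l (fun b => if b ⊆ G₂ then
          cobdry (fun t => y (t ∪ b)) s else 0) := by
        rw [cobdry_congr (g := fun t => ((AddMonoidHom.mulLeft (l z₂)⁻¹).comp l.toAddMonoidHom)
          fun b => if b ⊆ G₂ then y (t ∪ b) else 0), ← map_cobdry]
        · change (l z₂)⁻¹ * l _ = _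
          congr 2
          funext b
          rw [cobdry, Finset.sum_apply]
          by_cases hb : b ⊆ G₂
          · simp only [Pi.smul_apply, hb, if_true]; rfl
          · simp [hb]
        · intro i _
          exact if_pos ((Finset.erase_subset _ _).trans hsG)
      have hbd : IsStrandBdry A G₂ p₂ W₂ ((fun b => if b ⊆ G₂ then
          cobdry (fun t => y (t ∪ b)) s else 0) - z₁ s • z₂) := by
        refine ⟨fun b => if b ⊆ G₂ then -((-1 : ℤ) ^ s.card • y (s ∪ b)) else 0,
          fun b hb v hv => ?_, fun b hb => ?_⟩
        · obtain ⟨hb1, hb2⟩ := ite_ne_right_iff.1 hb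
          have hne : y (s ∪ b) ≠ 0 := fun h => hb2 (by simp [h])
          have hv' := hy _ hne (Finset.mem_union_right _ hv)
          rw [lab, Finset.union_biUnion, Finset.mem_union] at hv'
          exact hv'.resolve_left fun h =>
            Finset.disjoint_right.1 hlab (hW₂ hv) (lab_mono A hsG h)
        · obtain ⟨hbG, hbc⟩ := Finset.mem_powersetCard.1 hb
          obtain ⟨i1, i2⟩ := hinter hsG hbG
          have hsb : s ∪ b ⊆ G₁ ∪ G₂ := Finset.union_subset_union hsG hbG
          have h := hyz (s ∪ b) (Finset.mem_powersetCard.2 ⟨hsb, by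
            rw [Finset.card_union_of_disjoint (hdisj.mono hsG hbG), hsc, hbc]⟩)
          simp only [hsb, if_true, i1, i2] at h
          rw [cobdry_congr (g := fun t => y ((t ∩ G₁) ∪ (t ∩ G₂))) fun i _ => by
            rw [hsplit ((Finset.erase_subset _ _).trans hsb)],
            cobdry_inter_inter hlt (fun a b => y (a ∪ b)) hsb, i1, i2] at h
          have e := map_cobdry (zsmulAddGroupHom (-(-1 : ℤ) ^ s.card)) (fun t => y (s ∪ t)) b
          simp only [zsmulAddGroupHom_apply, neg_smul] at e
          rw [cobdry_congr (g := fun t => -((-1 : ℤ) ^ s.card • y (s ∪ t))) fun i _ =>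
            if_pos ((Finset.erase_subset _ _).trans hbG), ← e]
          simp only [Pi.sub_apply, Pi.smul_apply, smul_eq_mul, hbG, if_true, ← h]
          abel
      have h := hlB' _ hbd
      rw [map_sub, map_smul, sub_eq_zero] at h
      rw [hy₁, h, smul_eq_mul, mul_comm (z₁ s), inv_mul_cancel_left₀ hl]

end Kuenneth

section Cech

variable {Λ : Type*} {R : Type*} [CommRing R] {Q : Type*} [Field Q] [Algebra R Q]

variable (Q) in
/-- The localization of `R` at the elements `b i`, `i ∈ s`, inside `Q`. -/
def cechLoc (b : Λ → R) (s : Finset Λ) : Subalgebra R Q :=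
  Algebra.adjoin R ((fun i => (algebraMap R Q (b i))⁻¹) '' s)

theorem cechLoc_mono (b : Λ → R) {s t : Finset Λ} (h : s ⊆ t) : cechLoc Q b s ≤ cechLoc Q b t :=
  Algebra.adjoin_mono (Set.image_mono (Finset.coe_subset.2 h))

theorem inv_mem_cechLoc (b : Λ → R) {s : Finset Λ} {i : Λ} (hi : i ∈ s) :
    (algebraMap R Q (b i))⁻¹ ∈ cechLoc Q b s :=
  Algebra.subset_adjoin ⟨i, hi, rfl⟩

variable [LinearOrder Λ]

theorem cobdry_eq_of_mem {M : Type*} [AddCommGroup M] (f : Finset Λ → M) {c : Λ} {s : Finset Λ}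
    (hc : c ∈ s) : cobdry f s = faceSign c s •
      (f (s.erase c) - cobdry (fun t => faceSign c t • f (insert c t)) (s.erase c)) := by
  rw [cobdry, ← Finset.add_sum_erase _ _ hc, smul_sub, sub_eq_add_neg, cobdry, Finset.smul_sum,
    ← Finset.sum_neg_distrib]
  congr 1
  refine Finset.sum_congr rfl fun i hi => ?_
  obtain ⟨hic, his⟩ := Finset.mem_erase.1 hi
  have hins : insert c ((s.erase c).erase i) = s.erase i := by
    rw [Finset.erase_right_comm, Finset.insert_erase (Finset.mem_erase.2 ⟨hic.symm, hc⟩)]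
  have hsgn : faceSign c ((s.erase c).erase i) = faceSign c (s.erase i) := by
    rw [← hins, faceSign_insert_self]
  rw [hins, hsgn, smul_smul, smul_smul, ← neg_smul, faceSign_mul_faceSign_erase hc his hic.symm,
    neg_mul, neg_neg, mul_assoc, faceSign_mul_self, mul_one]

theorem exists_pow_mul_mem_cechLoc {b : Λ → R} (hb : ∀ i, algebraMap R Q (b i) ≠ 0)
    {s : Finset Λ} {i : Λ} {x : Q} (hx : x ∈ cechLoc Q b (insert i s)) :
    ∃ N, ∀ M ≥ N, algebraMap R Q (b i) ^ M * x ∈ cechLoc Q b s := by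
  suffices ∃ N, algebraMap R Q (b i) ^ N * x ∈ cechLoc Q b s by
    obtain ⟨N, hN⟩ := this
    refine ⟨N, fun M hM => ?_⟩
    obtain ⟨d, rfl⟩ := Nat.exists_eq_add_of_le hM
    rw [add_comm, pow_add, mul_assoc, ← map_pow]
    exact mul_mem (Subalgebra.algebraMap_mem _ _) hN
  induction hx using Algebra.adjoin_induction with
  | mem x hx =>
    obtain ⟨j, hj, rfl⟩ := hx
    rcases Finset.mem_insert.1 hj with rfl | hj
    · exact ⟨1, by rw [pow_one, mul_inv_cancel₀ (hb j)]; exact one_mem _⟩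
    · exact ⟨0, by rw [pow_zero, one_mul]; exact inv_mem_cechLoc b hj⟩
  | algebraMap r => exact ⟨0, by rw [pow_zero, one_mul]; exact Subalgebra.algebraMap_mem _ _⟩
  | add x y _ _ hx hy =>
    obtain ⟨N, hN⟩ := hx
    obtain ⟨M, hM⟩ := hy
    refine ⟨N + M, ?_⟩
    have : algebraMap R Q (b i) ^ (N + M) * (x + y) =
        algebraMap R Q (b i ^ M) * (algebraMap R Q (b i) ^ N * x) +
        algebraMap R Q (b i ^ N) * (algebraMap R Q (b i) ^ M * y) := by
      rw [map_pow, map_pow]; ring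
    rw [this]
    exact add_mem (mul_mem (Subalgebra.algebraMap_mem _ _) hN)
      (mul_mem (Subalgebra.algebraMap_mem _ _) hM)
  | mul x y _ _ hx hy =>
    obtain ⟨N, hN⟩ := hx
    obtain ⟨M, hM⟩ := hy
    refine ⟨N + M, ?_⟩
    rw [pow_add, mul_mul_mul_comm]
    exact mul_mem hN hM

theorem cobdry_mem_cechLoc {b : Λ → R} {f : Finset Λ → Q} (hf : ∀ s, f s ∈ cechLoc Q b s)
    (s : Finset Λ) : cobdry f s ∈ cechLoc Q b s :=
  sum_mem fun i _ => zsmul_mem (cechLoc_mono b (Finset.erase_subset i s) (hf _)) _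

/-- If `b c` lies in the radical of the ideal generated by the `b i`, `i ∈ H`, then the Čech complex
on these elements becomes exact once `b c` is inverted. -/
theorem exists_cobdry_eq_of_mem_radical {b : Λ → R} (hb : ∀ i, algebraMap R Q (b i) ≠ 0)
    {H : Finset Λ} {c : Λ} (hc : b c ∈ (Ideal.span (b '' H)).radical) {k : ℕ}
    {f : Finset Λ → Q} (hf : ∀ s, f s ∈ cechLoc Q b (insert c s))
    (hcoc : ∀ s ∈ H.powersetCard (k + 1), cobdry f s = 0) :
    ∃ h : Finset Λ → Q, (∀ s, h s ∈ cechLoc Q b (insert c s)) ∧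
      ∀ s ∈ H.powersetCard k, cobdry h s = f s := by
  classical
  set β : Λ → Q := fun i => algebraMap R Q (b i) with hβ
  have hloc : ∀ (s : Finset Λ) (i : Λ), ∃ N, ∀ M ≥ N, i ∈ s →
      β i ^ M * f s ∈ cechLoc Q b (insert c (s.erase i)) := fun s i => by
    by_cases hi : i ∈ s
    · have : f s ∈ cechLoc Q b (insert i (insert c (s.erase i))) := by
        rw [Finset.insert_comm, Finset.insert_erase hi]; exact hf s
      obtain ⟨N, hN⟩ := exists_pow_mul_mem_cechLoc hb this
      exact ⟨N, fun M hM _ => hN M hM⟩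
    · exact ⟨0, fun _ _ h => absurd h hi⟩
  choose N hN using hloc
  let M := ∑ s ∈ H.powerset, ∑ i ∈ H, N s i
  have hM : ∀ s ⊆ H, ∀ i ∈ s, β i ^ M * f s ∈ cechLoc Q b (insert c (s.erase i)) :=
    fun s hs i hi => hN s i M ((Finset.single_le_sum (f := fun i => N s i)
      (fun _ _ => Nat.zero_le _) (hs hi)).trans
      (Finset.single_le_sum (f := fun s => ∑ i ∈ H, N s i) (fun _ _ => Nat.zero_le _)
        (Finset.mem_powerset.2 hs))) hi
  have hpow : b c ∈ (Ideal.span ((fun i => b i ^ M) '' H)).radical := by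
    have hle : Ideal.span (b '' H) ≤ (Ideal.span ((fun i => b i ^ M) '' H)).radical := by
      rw [Ideal.span_le]
      rintro _ ⟨i, hi, rfl⟩
      exact ⟨M, Ideal.subset_span ⟨i, hi, rfl⟩⟩
    exact Ideal.radical_le_radical_iff.2 hle hc
  obtain ⟨L, hL⟩ := hpow
  obtain ⟨a', ha'⟩ := (Submodule.mem_span_image_finset_iff_exists_fun R).1 hL
  let a : Λ → R := fun i => if hi : i ∈ H then a' ⟨i, hi⟩ else 0
  have ha : ∑ i ∈ H, a i * b i ^ M = b c ^ L := by
    rw [← ha', ← Finset.sum_coe_sort]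
    exact Finset.sum_congr rfl fun i _ => by simp only [a, i.2, dif_pos, smul_eq_mul]
  let u : Λ → Q := fun i => algebraMap R Q (a i) * β i ^ M * (β c)⁻¹ ^ L
  have hu : ∑ i ∈ H, u i = 1 := by
    have h := congrArg (algebraMap R Q) ha
    simp only [map_sum, map_mul, map_pow] at h
    simp only [u]
    rw [← Finset.sum_mul, h, ← mul_pow, mul_inv_cancel₀ (hb c), one_pow]
  refine ⟨fun t => if t ⊆ H then ∑ j ∈ H \ t, faceSign j t • (u j * f (insert j t)) else 0,
    fun t => ?_, fun s hs => ?_⟩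
  · dsimp only
    split_ifs with ht
    · refine sum_mem fun j hj => zsmul_mem ?_ _
      obtain ⟨hjH, hjt⟩ := Finset.mem_sdiff.1 hj
      have h := hM (insert j t) (Finset.insert_subset hjH ht) j (Finset.mem_insert_self j t)
      rw [Finset.erase_insert hjt] at h
      have e : u j * f (insert j t) =
          algebraMap R Q (a j) * (β c)⁻¹ ^ L * (β j ^ M * f (insert j t)) := by
        simp only [u]; ring
      rw [e]
      exact mul_mem (mul_mem (Subalgebra.algebraMap_mem _ _)
        (pow_mem (inv_mem_cechLoc b (Finset.mem_insert_self c t)) _)) h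
    · exact zero_mem _
  · have hsH := (Finset.mem_powersetCard.1 hs).1
    have h := bdry_cobdry_homotopy H (fun _ => AddMonoidHom.id Q)
      (fun i => AddMonoidHom.mulLeft (u i)) (fun _ _ _ => rfl) f hsH
    simp only [AddMonoidHom.id_apply, AddMonoidHom.coe_mulLeft] at h
    rw [← Finset.sum_mul, hu, one_mul, Finset.sum_eq_zero, zero_add] at h
    · rw [← h]
      exact Finset.sum_congr rfl fun i _ => congrArg (faceSign i s • ·)
        (if_pos ((Finset.erase_subset _ _).trans hsH))
    · intro j hj
      have hj := Finset.mem_sdiff.1 hj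
      have h0 : cobdry f (insert j s) = 0 := hcoc _ (by
        rw [Finset.mem_powersetCard] at hs ⊢
        exact ⟨Finset.insert_subset hj.1 hs.1, by
          rw [Finset.card_insert_of_notMem hj.2, hs.2]⟩)
      rw [cobdry] at h0
      rw [h0, mul_zero, smul_zero]

variable (Q) in
/-- Exactness in degree `k` of the Čech complex on the elements `b i`, `i ∈ G`. -/
def CechExact (b : Λ → R) (G : Finset Λ) (k : ℕ) : Prop :=
  ∀ f : Finset Λ → Q, (∀ s, f s ∈ cechLoc Q b s) →
    (∀ s ∈ G.powersetCard (k + 1), cobdry f s = 0) →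
    ∃ g : Finset Λ → Q, (∀ s, g s ∈ cechLoc Q b s) ∧ ∀ s ∈ G.powersetCard k, cobdry g s = f s

theorem CechExact.of_insert {b : Λ → R} (hb : ∀ i, algebraMap R Q (b i) ≠ 0)
    {H : Finset Λ} {c : Λ} (hcH : c ∉ H) (hc : b c ∈ (Ideal.span (b '' H)).radical) {k : ℕ}
    (hE : CechExact Q b (insert c H) k) : CechExact Q b H k := by
  intro f hf hcoc
  obtain ⟨h, hh, hhf⟩ := exists_cobdry_eq_of_mem_radical hb hc
    (fun s => cechLoc_mono b (Finset.subset_insert c s) (hf s)) hcoc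
  let F : Finset Λ → Q := fun s => if c ∈ s then faceSign c s • h (s.erase c) else f s
  have hF0 : ∀ s, c ∉ s → F s = f s := fun s hs => if_neg hs
  have hF1 : ∀ s, c ∉ s → faceSign c s • F (insert c s) = h s := fun s hs => by
    simp only [F, Finset.mem_insert_self, if_true, Finset.erase_insert hs, faceSign_insert_self,
      faceSign_smul_smul]
  obtain ⟨g, hg, hgF⟩ := hE F (fun s => by
    by_cases hs : c ∈ s
    · have := hh (s.erase c)
      rw [Finset.insert_erase hs] at this
      simp only [F, hs, if_true]
      exact zsmul_mem this _
    · rw [hF0 s hs]; exact hf s) (fun s hs => by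
    obtain ⟨hs1, hs2⟩ := Finset.mem_powersetCard.1 hs
    by_cases hcs : c ∈ s
    · have hmem : s.erase c ∈ H.powersetCard k := by
        rw [Finset.mem_powersetCard]
        exact ⟨Finset.subset_insert_iff.1 hs1, by rw [Finset.card_erase_of_mem hcs, hs2]; rfl⟩
      rw [cobdry_eq_of_mem F hcs, hF0 _ (Finset.notMem_erase c s),
        cobdry_congr fun i _ =>
          hF1 _ fun hi => Finset.notMem_erase c s (Finset.mem_of_mem_erase hi),
        hhf _ hmem, sub_self, smul_zero]
    · rw [cobdry_congr fun i _ => hF0 _ fun hi => hcs (Finset.mem_of_mem_erase hi)]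
      exact hcoc s (Finset.mem_powersetCard.2
        ⟨(Finset.subset_insert_iff_of_notMem hcs).1 hs1, hs2⟩))
  refine ⟨g, hg, fun s hs => ?_⟩
  obtain ⟨hs1, hs2⟩ := Finset.mem_powersetCard.1 hs
  rw [hgF s (Finset.mem_powersetCard.2 ⟨hs1.trans (Finset.subset_insert c H), hs2⟩),
    hF0 s fun h => hcH (hs1 h)]

theorem CechExact.insert_vertex {b : Λ → R} (hb : ∀ i, algebraMap R Q (b i) ≠ 0)
    {H : Finset Λ} {c : Λ} (hcH : c ∉ H) (hc : b c ∈ (Ideal.span (b '' H)).radical) {k : ℕ}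
    (hE : CechExact Q b H (k + 1)) : CechExact Q b (insert c H) (k + 1) := by
  intro f hf hcoc
  have hsub : ∀ {s : Finset Λ} {n : ℕ}, s ∈ H.powersetCard n → s ∈ (insert c H).powersetCard n :=
    fun hs => Finset.powersetCard_mono (Finset.subset_insert c H) hs
  obtain ⟨g₀, hg₀, hg₀f⟩ := hE f hf fun s hs => hcoc s (hsub hs)
  let g₁ : Finset Λ → Q := fun s => if c ∈ s then 0 else g₀ s
  have hg₁ : ∀ s, g₁ s ∈ cechLoc Q b s := fun s => by
    simp only [g₁]
    split_ifs
    · exact zero_mem _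
    · exact hg₀ s
  let F : Finset Λ → Q := fun s => f s - cobdry g₁ s
  have hFmem : ∀ s, F s ∈ cechLoc Q b s := fun s => sub_mem (hf s) (cobdry_mem_cechLoc hg₁ s)
  have hFcoc : ∀ s ∈ (insert c H).powersetCard (k + 2), cobdry F s = 0 := fun s hs => by
    rw [cobdry_sub, hcoc s hs]
    exact (sub_eq_zero.2 (cobdry_cobdry g₁ s).symm)
  have hF0 : ∀ s ∈ H.powersetCard (k + 1), F s = 0 := fun s hs => by
    have hcs : c ∉ s := fun h => hcH ((Finset.mem_powersetCard.1 hs).1 h)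
    simp only [F]
    rw [cobdry_congr fun i _ => if_neg fun hi => hcs (Finset.mem_of_mem_erase hi), hg₀f s hs,
      sub_self]
  obtain ⟨h, hh, hhF⟩ := exists_cobdry_eq_of_mem_radical hb hc (k := k)
    (f := fun s => faceSign c s • F (insert c s)) (fun s => zsmul_mem (hFmem _) _)
    (fun s hs => by
      obtain ⟨hs1, hs2⟩ := Finset.mem_powersetCard.1 hs
      have hcs : c ∉ s := fun h => hcH (hs1 h)
      have h := hFcoc (insert c s) (Finset.mem_powersetCard.2
        ⟨Finset.insert_subset_insert c hs1, by rw [Finset.card_insert_of_notMem hcs, hs2]⟩)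
      rw [cobdry_eq_of_mem F (Finset.mem_insert_self c s), Finset.erase_insert hcs, hF0 s hs,
        zero_sub, smul_neg, neg_eq_zero] at h
      have := congrArg (fun x => faceSign c (insert c s) • x) h
      rwa [smul_zero, faceSign_smul_smul] at this)
  let g₂ : Finset Λ → Q := fun s => if c ∈ s then -(faceSign c s • h (s.erase c)) else 0
  have hg₂0 : ∀ s, c ∉ s → g₂ s = 0 := fun s hs => if_neg hs
  have hg₂1 : ∀ s, c ∉ s → faceSign c s • g₂ (insert c s) = -h s := fun s hs => by
    simp only [g₂, Finset.mem_insert_self, if_true, Finset.erase_insert hs, faceSign_insert_self,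
      smul_neg, faceSign_smul_smul]
  refine ⟨fun s => g₁ s + g₂ s, fun s => add_mem (hg₁ s) ?_, fun s hs => ?_⟩
  · by_cases hs : c ∈ s
    · have := hh (s.erase c)
      rw [Finset.insert_erase hs] at this
      simp only [g₂, hs, if_true]
      exact neg_mem (zsmul_mem this _)
    · rw [hg₂0 s hs]; exact zero_mem _
  · suffices cobdry g₂ s = F s by
      rw [cobdry_add, this]; simp only [F]; abel
    obtain ⟨hs1, hs2⟩ := Finset.mem_powersetCard.1 hs
    by_cases hcs : c ∈ s
    · have hmem : s.erase c ∈ H.powersetCard k := by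
        rw [Finset.mem_powersetCard]
        exact ⟨Finset.subset_insert_iff.1 hs1, by rw [Finset.card_erase_of_mem hcs, hs2]; rfl⟩
      have hneg := map_cobdry (-AddMonoidHom.id Q) h (s.erase c)
      rw [cobdry_eq_of_mem g₂ hcs, hg₂0 _ (Finset.notMem_erase c s),
        cobdry_congr (g := fun t => -h t) fun i _ =>
          hg₂1 _ fun hi => Finset.notMem_erase c s (Finset.mem_of_mem_erase hi)]
      simp only [AddMonoidHom.neg_apply, AddMonoidHom.id_apply] at hneg
      rw [← hneg, hhF _ hmem, Finset.insert_erase hcs, zero_sub, neg_neg, faceSign_erase_self,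
        faceSign_smul_smul]
    · have hsH : s ∈ H.powersetCard (k + 1) := Finset.mem_powersetCard.2
        ⟨(Finset.subset_insert_iff_of_notMem hcs).1 hs1, hs2⟩
      rw [hF0 s hsH]
      refine Finset.sum_eq_zero fun i _ => ?_
      rw [hg₂0 _ fun hi => hcs (Finset.mem_of_mem_erase hi), smul_zero]

theorem cechExact_of_card_lt {b : Λ → R} (hb : ∀ i, algebraMap R Q (b i) ≠ 0)
    {G H : Finset Λ} (hG : ∀ i ∈ G, b i ∈ (Ideal.span (b '' H)).radical)
    (hH : ∀ i ∈ H, b i ∈ (Ideal.span (b '' G)).radical) {k : ℕ} (hk : H.card < k + 1) :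
    CechExact Q b G (k + 1) := by
  have hmono : ∀ {D E : Finset Λ}, D ⊆ E →
      (Ideal.span (b '' D)).radical ≤ (Ideal.span (b '' E)).radical := fun h =>
    Ideal.radical_mono (Ideal.span_mono (Set.image_mono (Finset.coe_subset.2 h)))
  have hadd : ∀ G' ⊆ G, CechExact Q b (G' ∪ H) (k + 1) := by
    intro G'
    induction G' using Finset.induction_on with
    | empty =>
      intro _ f _ _
      refine ⟨0, fun s => zero_mem _, fun s hs => ?_⟩
      rw [Finset.empty_union, Finset.powersetCard_eq_empty.2 hk] at hs
      simp at hs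
    | insert c G' _ ih =>
      intro hcG
      have ih := ih ((Finset.subset_insert c G').trans hcG)
      rw [Finset.insert_union]
      by_cases hc : c ∈ G' ∪ H
      · rwa [Finset.insert_eq_of_mem hc]
      · exact ih.insert_vertex hb hc (hmono Finset.subset_union_right
          (hG c (hcG (Finset.mem_insert_self c G'))))
  have hdel : ∀ H' ⊆ H, CechExact Q b (G ∪ H') (k + 1) → CechExact Q b G (k + 1) := by
    intro H'
    induction H' using Finset.induction_on with
    | empty => intro _ h; rwa [Finset.union_empty] at h
    | insert c H' _ ih =>
      intro hcH h
      refine ih ((Finset.subset_insert c H').trans hcH) ?_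
      rw [Finset.union_insert] at h
      by_cases hc : c ∈ G ∪ H'
      · rwa [Finset.insert_eq_of_mem hc] at h
      · exact h.of_insert hb hc (hmono Finset.subset_union_left
          (hH c (hcH (Finset.mem_insert_self c H'))))
  exact hdel H subset_rfl (hadd G subset_rfl)

end Cech

section Clearing

variable {K : Type u} [Field K] {V : Type} [DecidableEq V] {A : ℕ → Finset V}
  {Q : Type*} [Field Q] [Algebra (MvPolynomial V K) Q]

theorem sqfMon_lab_dvd_prod (s : Finset ℕ) :
    sqfMon K (lab A s) ∣ ∏ i ∈ s, sqfMon K (A i) := by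
  induction s using Finset.induction_on with
  | empty => simp [lab, sqfMon]
  | insert i s hi ih =>
    rw [Finset.prod_insert hi, lab_insert, ← Finset.union_sdiff_self_eq_union,
      sqfMon_union_of_disjoint Finset.disjoint_sdiff]
    exact mul_dvd_mul_left _ ((sqfMon_dvd_sqfMon Finset.sdiff_subset).trans ih)

theorem inv_sqfMon_mem_cechLoc (hinj : Function.Injective (algebraMap (MvPolynomial V K) Q))
    {b : ℕ → MvPolynomial V K} {s : Finset ℕ} (hb : ∀ i ∈ s, b i = sqfMon K (A i))
    {W : Finset V} (hW : W ⊆ lab A s) :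
    (algebraMap (MvPolynomial V K) Q (sqfMon K W))⁻¹ ∈ cechLoc Q b s := by
  obtain ⟨c, hc⟩ := (sqfMon_dvd_sqfMon (K := K) hW).trans (sqfMon_lab_dvd_prod s)
  rw [← Finset.prod_congr rfl hb] at hc
  have h0 : ∀ i ∈ s, algebraMap (MvPolynomial V K) Q (b i) ≠ 0 := fun i hi => by
    rw [hb i hi]
    exact (map_ne_zero_iff _ hinj).2 (sqfMon_ne_zero _)
  have hW0 : algebraMap (MvPolynomial V K) Q (sqfMon K W) ≠ 0 :=
    (map_ne_zero_iff _ hinj).2 (sqfMon_ne_zero _)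
  have hinv : (algebraMap (MvPolynomial V K) Q (sqfMon K W))⁻¹ =
      algebraMap (MvPolynomial V K) Q c * ∏ i ∈ s, (algebraMap (MvPolynomial V K) Q (b i))⁻¹ := by
    have h := congrArg (algebraMap (MvPolynomial V K) Q) hc
    rw [map_prod, map_mul] at h
    rw [Finset.prod_inv_distrib, h, mul_inv, mul_left_comm, mul_inv_cancel₀, mul_one]
    intro hc0
    rw [hc0, mul_zero] at h
    exact Finset.prod_ne_zero_iff.2 h0 h
  rw [hinv]
  exact mul_mem (Subalgebra.algebraMap_mem _ _) (prod_mem fun i hi => inv_mem_cechLoc b hi)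

variable [Fintype V]

theorem sqfMon_univ_eq (W : Finset V) :
    sqfMon K (Finset.univ : Finset V) = sqfMon K W * sqfMon K (Finset.univ \ W) := by
  rw [← sqfMon_union_of_disjoint Finset.disjoint_sdiff,
    Finset.union_sdiff_of_subset (Finset.subset_univ W)]

/-- Clearing denominators in `cechLoc Q b s` with a power of the product of all variables leaves
a polynomial divisible by the same power of the variables outside `lab A s`. -/
theorem exists_pow_mul_eq_algebraMap
    (hinj : Function.Injective (algebraMap (MvPolynomial V K) Q))
    {b : ℕ → MvPolynomial V K} {s : Finset ℕ} (hb : ∀ i ∈ s, b i = sqfMon K (A i)) {x : Q}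
    (hx : x ∈ cechLoc Q b s) : ∃ N, ∀ M ≥ N, ∃ p : MvPolynomial V K,
      algebraMap (MvPolynomial V K) Q (sqfMon K (Finset.univ : Finset V)) ^ M * x =
        algebraMap (MvPolynomial V K) Q p ∧
        sqfMon K (Finset.univ \ lab A s) ^ M ∣ p := by
  induction hx using Algebra.adjoin_induction with
  | mem x hx =>
    obtain ⟨i, hi, rfl⟩ := hx
    refine ⟨1, fun M hM => ?_⟩
    obtain ⟨m, rfl⟩ := Nat.exists_eq_add_of_le' hM
    refine ⟨sqfMon K Finset.univ ^ m * sqfMon K (Finset.univ \ A i), ?_, ?_⟩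
    · have h0 : algebraMap (MvPolynomial V K) Q (b i) ≠ 0 := by
        rw [hb i hi]
        exact (map_ne_zero_iff _ hinj).2 (sqfMon_ne_zero _)
      have hX : sqfMon K (Finset.univ : Finset V) = b i * sqfMon K (Finset.univ \ A i) := by
        rw [hb i hi, ← sqfMon_univ_eq]
      rw [eq_comm, map_mul, map_pow, pow_succ, mul_assoc]
      congr 1
      conv_rhs => rw [hX]
      rw [map_mul, mul_right_comm, mul_inv_cancel₀ h0, one_mul]
    · rw [pow_succ]
      exact mul_dvd_mul (pow_dvd_pow_of_dvd (sqfMon_dvd_sqfMon (Finset.subset_univ _)) m)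
        (sqfMon_dvd_sqfMon (Finset.sdiff_subset_sdiff subset_rfl (subset_lab A hi)))
  | algebraMap r =>
    exact ⟨0, fun M _ => ⟨sqfMon K Finset.univ ^ M * r, by rw [map_mul, map_pow],
      (pow_dvd_pow_of_dvd (sqfMon_dvd_sqfMon (Finset.subset_univ _)) M).mul_right r⟩⟩
  | add x y _ _ hx hy =>
    obtain ⟨N₁, h₁⟩ := hx
    obtain ⟨N₂, h₂⟩ := hy
    refine ⟨N₁ + N₂, fun M hM => ?_⟩
    obtain ⟨p, hp, hp'⟩ := h₁ M ((Nat.le_add_right _ _).trans hM)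
    obtain ⟨q, hq, hq'⟩ := h₂ M ((Nat.le_add_left _ _).trans hM)
    exact ⟨p + q, by rw [mul_add, hp, hq, map_add], dvd_add hp' hq'⟩
  | mul x y _ _ hx hy =>
    obtain ⟨N₁, h₁⟩ := hx
    obtain ⟨N₂, h₂⟩ := hy
    refine ⟨N₁ + N₂, fun M hM => ?_⟩
    obtain ⟨d, rfl⟩ := Nat.exists_eq_add_of_le hM
    obtain ⟨p, hp, hp'⟩ := h₁ N₁ le_rfl
    obtain ⟨q, hq, hq'⟩ := h₂ (N₂ + d) (Nat.le_add_right _ _)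
    refine ⟨p * q, ?_, ?_⟩
    · rw [add_assoc, pow_add, mul_mul_mul_comm, hp, hq, map_mul]
    · rw [add_assoc, pow_add]
      exact mul_dvd_mul hp' hq'

theorem not_cechExact (hinj : Function.Injective (algebraMap (MvPolynomial V K) Q))
    {b : ℕ → MvPolynomial V K} {G : Finset ℕ} (hb : ∀ i ∈ G, b i = sqfMon K (A i)) {k : ℕ}
    {W : Finset V} (h : StrandNonexact K A G k W) : ¬ CechExact Q b G k := by
  intro hE
  obtain ⟨z, hz, hcoc, hbdry⟩ := h
  refine hbdry ?_
  let w : Q := (algebraMap (MvPolynomial V K) Q (sqfMon K W))⁻¹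
  let φ : K →+ Q := (AddMonoidHom.mulRight w).comp
    ((algebraMap (MvPolynomial V K) Q).comp C).toAddMonoidHom
  obtain ⟨g, hg, hgz⟩ := hE (fun s => φ (z s)) (fun s => by
    by_cases hs : z s = 0
    · simp only [hs, map_zero]
      exact zero_mem _
    · obtain ⟨hsG, hW⟩ := hz s hs
      exact mul_mem (Subalgebra.algebraMap_mem _ _) (inv_sqfMon_mem_cechLoc hinj
        (fun i hi => hb i ((Finset.mem_powersetCard.1 hsG).1 hi)) hW)) (fun s hs => by
    rw [← map_cobdry, hcoc s hs, map_zero])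
  have hclear : ∀ t : Finset ℕ, ∃ N, t ⊆ G → ∀ M ≥ N, ∃ p : MvPolynomial V K,
      algebraMap (MvPolynomial V K) Q (sqfMon K (Finset.univ : Finset V)) ^ M * g t =
        algebraMap (MvPolynomial V K) Q p ∧
        sqfMon K (Finset.univ \ lab A t) ^ M ∣ p := fun t => by
    by_cases ht : t ⊆ G
    · obtain ⟨N, hN⟩ := exists_pow_mul_eq_algebraMap hinj (fun i hi => hb i (ht hi)) (hg t)
      exact ⟨N, fun _ => hN⟩
    · exact ⟨0, fun h => absurd h ht⟩
  choose N hN using hclear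
  let M := ∑ t ∈ G.powerset, N t
  have hM : ∀ t : Finset ℕ, ∃ p : MvPolynomial V K, t ⊆ G →
      algebraMap (MvPolynomial V K) Q (sqfMon K (Finset.univ : Finset V)) ^ (M + 1) * g t =
        algebraMap (MvPolynomial V K) Q p ∧
        sqfMon K (Finset.univ \ lab A t) ^ (M + 1) ∣ p := fun t => by
    by_cases ht : t ⊆ G
    · obtain ⟨p, hp⟩ := hN t ht (M + 1) ((Finset.single_le_sum (f := N)
        (fun _ _ => Nat.zero_le _) (Finset.mem_powerset.2 ht)).trans (Nat.le_succ _))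
      exact ⟨p, fun _ => hp⟩
    · exact ⟨0, fun h => absurd h ht⟩
  choose p hp using hM
  let e : V →₀ ℕ := M • indExp Finset.univ + indExp (Finset.univ \ W)
  refine ⟨fun t => if t ⊆ G then coeff e (p t) else 0, fun t ht => ?_, fun s hs => ?_⟩
  · have htG : t ⊆ G := by
      by_contra h
      exact ht (if_neg h)
    have hdvd := (hp t htG).2
    rw [sqfMon_eq_monomial, monomial_pow, one_pow, monomial_one_dvd_iff] at hdvd
    have hle := hdvd e fun h => ht ((if_pos htG).trans h)
    intro v hv
    by_contra hvt
    have := hle v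
    simp [e, indExp_apply, hv, hvt] at this
  · have hsG := (Finset.mem_powersetCard.1 hs).1
    have hsub : ∀ i, s.erase i ⊆ G := fun i => (Finset.erase_subset i s).trans hsG
    rw [cobdry_congr (g := fun t => lcoeff K e (p t)) fun i _ => if_pos (hsub i),
      ← map_cobdry]
    have hps : cobdry p s = C (z s) * monomial e 1 := by
      apply hinj
      rw [map_cobdry, ← cobdry_congr (f := fun t =>
        algebraMap (MvPolynomial V K) Q (sqfMon K (Finset.univ : Finset V)) ^ (M + 1) * g t)
        fun i _ => (hp _ (hsub i)).1]
      have hmul := map_cobdry (AddMonoidHom.mulLeft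
        (algebraMap (MvPolynomial V K) Q (sqfMon K (Finset.univ : Finset V)) ^ (M + 1))) g s
      simp only [AddMonoidHom.coe_mulLeft] at hmul
      rw [← hmul, hgz s hs]
      have hW0 : algebraMap (MvPolynomial V K) Q (sqfMon K W) ≠ 0 :=
        (map_ne_zero_iff _ hinj).2 (sqfMon_ne_zero _)
      have he : monomial e (1 : K) =
          sqfMon K Finset.univ ^ M * sqfMon K (Finset.univ \ W) := by
        rw [sqfMon_eq_monomial, sqfMon_eq_monomial, monomial_pow, monomial_mul, one_pow, one_mul]
      have hX : algebraMap (MvPolynomial V K) Q (sqfMon K (Finset.univ : Finset V)) =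
          algebraMap (MvPolynomial V K) Q (sqfMon K W) *
            algebraMap (MvPolynomial V K) Q (sqfMon K (Finset.univ \ W)) := by
        rw [← map_mul, ← sqfMon_univ_eq]
      have hφ : φ (z s) = algebraMap (MvPolynomial V K) Q (C (z s)) * w := rfl
      rw [he, map_mul, map_mul, map_pow, pow_succ, hφ]
      nth_rewrite 2 [hX]
      simp only [w]
      field_simp
    rw [hps, lcoeff_apply, coeff_C_mul, coeff_monomial, if_pos rfl, mul_one]

end Clearing

section ArithmeticRank

variable {K : Type u} [Field K] {V : Type} [DecidableEq V] [Fintype V] {A : ℕ → Finset V}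

theorem StrandNonexact.le_of_radical_eq {G : Finset ℕ} {k : ℕ} {W : Finset V}
    (h : StrandNonexact K A G (k + 1) W) {r : ℕ} (a : Fin r → MvPolynomial V K)
    (ha : (Ideal.span (Set.range a)).radical = (sqfIdeal K A G).radical) : k + 1 ≤ r := by
  classical
  by_contra! hr
  obtain ⟨m, hm⟩ : ∃ m, ∀ i ∈ G, i < m :=
    ⟨G.sup id + 1, fun i hi => Nat.lt_succ_of_le (Finset.le_sup (f := id) hi)⟩
  let a' : ℕ → MvPolynomial V K := fun j => if hj : j < r then a ⟨j, hj⟩ else 0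
  let b : ℕ → MvPolynomial V K := fun i => if i ∈ G then sqfMon K (A i) else
    if a' (i - m) = 0 then 1 else a' (i - m)
  let H : Finset ℕ := ((Finset.range r).filter fun j => a' j ≠ 0).image (m + ·)
  have hbG : ∀ i ∈ G, b i = sqfMon K (A i) := fun i hi => if_pos hi
  have hbH : ∀ j, a' j ≠ 0 → b (m + j) = a' j := fun j hj => by
    have hmG : m + j ∉ G := fun h => absurd (hm _ h) (by lia)
    simp only [b, hmG, if_false, Nat.add_sub_cancel_left, hj]
  have hb0 : ∀ i, b i ≠ 0 := fun i => by
    simp only [b]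
    split_ifs with h₁ h₂
    · exact sqfMon_ne_zero _
    · exact one_ne_zero
    · exact h₂
  have hspanG : Ideal.span (b '' G) = sqfIdeal K A G := by
    rw [sqfIdeal]
    exact congrArg Ideal.span (Set.image_congr hbG)
  have hspanH : Ideal.span (b '' H) = Ideal.span (Set.range a) := by
    refine le_antisymm (Ideal.span_le.2 ?_) (Ideal.span_le.2 ?_)
    · rintro _ ⟨i, hi, rfl⟩
      obtain ⟨j, hj, rfl⟩ := Finset.mem_image.1 hi
      obtain ⟨hjr, hj0⟩ := Finset.mem_filter.1 hj
      rw [hbH j hj0]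
      simp only [a', Finset.mem_range.1 hjr, dif_pos]
      exact Ideal.subset_span ⟨_, rfl⟩
    · rintro _ ⟨j, rfl⟩
      by_cases hj : a j = 0
      · rw [hj]
        exact zero_mem _
      · have haj : a' j = a j := dif_pos j.2
        rw [← haj, ← hbH j (haj ▸ hj)]
        exact Ideal.subset_span ⟨m + j, Finset.mem_image.2 ⟨j, Finset.mem_filter.2
          ⟨Finset.mem_range.2 j.2, haj ▸ hj⟩, rfl⟩, rfl⟩
  have hinj := IsFractionRing.injective (MvPolynomial V K) (FractionRing (MvPolynomial V K))
  refine not_cechExact hinj hbG h (cechExact_of_card_lt (H := H)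
    (fun i => (map_ne_zero_iff _ hinj).2 (hb0 i)) (fun i hi => ?_) (fun i hi => ?_) ?_)
  · rw [hspanH, ha, ← hspanG]
    exact Ideal.le_radical (Ideal.subset_span ⟨i, hi, rfl⟩)
  · rw [hspanG, ← ha, ← hspanH]
    exact Ideal.le_radical (Ideal.subset_span ⟨i, hi, rfl⟩)
  · refine lt_of_le_of_lt (Finset.card_image_le.trans (Finset.card_filter_le _ _)) ?_
    rwa [Finset.card_range]

end ArithmeticRank

section Quotients

variable {R : Type u} [CommRing R]

theorem hasProjectiveDimensionLT_prod {M N : Type u} [AddCommGroup M] [Module R M]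
    [AddCommGroup N] [Module R N] {n : ℕ} (hM : HasProjectiveDimensionLT (ModuleCat.of R M) n)
    (hN : HasProjectiveDimensionLT (ModuleCat.of R N) n) :
    HasProjectiveDimensionLT (ModuleCat.of R (M × N)) n := by
  have hS := ModuleCat.shortComplex_shortExact
    (ModuleCat.shortComplexOfCompEqZero (LinearMap.inl R M N) (LinearMap.snd R M N)
      (LinearMap.snd_comp_inl R M N))
    Function.Exact.inl_snd LinearMap.inl_injective Prod.snd_surjective
  exact hS.hasProjectiveDimensionLT_X₂ n hM hN

theorem hasProjectiveDimensionLT_quotient_sup {I J : Ideal R} {n : ℕ}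
    (h : HasProjectiveDimensionLT (ModuleCat.of R (R ⧸ (I ⊓ J))) n)
    (hI : HasProjectiveDimensionLT (ModuleCat.of R (R ⧸ I)) (n + 1))
    (hJ : HasProjectiveDimensionLT (ModuleCat.of R (R ⧸ J)) (n + 1)) :
    HasProjectiveDimensionLT (ModuleCat.of R (R ⧸ (I ⊔ J))) (n + 1) := by
  let f : R ⧸ (I ⊓ J) →ₗ[R] (R ⧸ I) × (R ⧸ J) :=
    (Submodule.factor inf_le_left).prod (Submodule.factor inf_le_right)
  let g : (R ⧸ I) × (R ⧸ J) →ₗ[R] R ⧸ (I ⊔ J) :=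
    (Submodule.factor le_sup_left).comp (LinearMap.fst R _ _) -
      (Submodule.factor le_sup_right).comp (LinearMap.snd R _ _)
  have hfg : g.comp f = 0 := by
    ext
    simp [f, g]
  have hS := ModuleCat.shortComplex_shortExact
    (ModuleCat.shortComplexOfCompEqZero f g hfg) (fun x => ⟨fun hx => ?_, ?_⟩) ?_ ?_
  · exact hS.hasProjectiveDimensionLT_X₃ n h (hasProjectiveDimensionLT_prod hI hJ)
  · obtain ⟨x, y⟩ := x
    obtain ⟨x, rfl⟩ := Submodule.mkQ_surjective _ x
    obtain ⟨y, rfl⟩ := Submodule.mkQ_surjective _ y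
    have hxy : x - y ∈ I ⊔ J := (Submodule.Quotient.eq _).1 (sub_eq_zero.1 hx)
    obtain ⟨a, ha, b, hb, hab⟩ := Submodule.mem_sup.1 hxy
    refine ⟨Submodule.mkQ _ (x - a), Prod.ext ?_ ?_⟩
    · exact (Submodule.Quotient.eq _).2 (by simpa using ha)
    · exact (Submodule.Quotient.eq _).2 (by
        rw [LinearMap.id_apply, sub_right_comm, ← hab, add_sub_cancel_left]; exact hb)
  · rintro ⟨x, rfl⟩
    exact LinearMap.congr_fun hfg x
  · refine (injective_iff_map_eq_zero f).2 fun x hx => ?_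
    obtain ⟨x, rfl⟩ := Submodule.mkQ_surjective _ x
    obtain ⟨h₁, h₂⟩ := Prod.ext_iff.1 hx
    exact (Submodule.Quotient.mk_eq_zero _).2
      ⟨(Submodule.Quotient.mk_eq_zero _).1 h₁, (Submodule.Quotient.mk_eq_zero _).1 h₂⟩
  · intro x
    obtain ⟨x, rfl⟩ := Submodule.mkQ_surjective _ x
    exact ⟨(Submodule.mkQ _ x, 0), by simp [g]⟩

end Quotients

section SchmittVogel

variable {R : Type*} [CommRing R]

theorem ara_le {I : Ideal R} {r : ℕ} (a : Fin r → R)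
    (ha : (Ideal.span (Set.range a)).radical = I.radical) : ara I ≤ r :=
  Nat.sInf_le ⟨a, ha⟩

theorem exists_radical_span_range_eq {I : Ideal R} (hI : I.FG) {r : ℕ} (hr : ara I = r) :
    ∃ a : Fin r → R, (Ideal.span (Set.range a)).radical = I.radical := by
  subst hr
  obtain ⟨s, rfl⟩ := hI
  refine Nat.sInf_mem (s := {r : ℕ | ∃ a : Fin r → R, (Ideal.span (Set.range a)).radical =
    (Ideal.span (s : Set R)).radical}) ⟨s.card, fun i => s.equivFin.symm i, ?_⟩
  congr 2
  ext x
  constructor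
  · rintro ⟨i, rfl⟩
    exact (s.equivFin.symm i).2
  · intro hx
    exact ⟨s.equivFin ⟨x, hx⟩, by simp⟩

/-- The polynomial with coefficients `a 0, …, a (r - 1)`. -/
noncomputable def finPoly {r : ℕ} (a : Fin r → R) : Polynomial R :=
  ∑ i : Fin r, Polynomial.monomial (i : ℕ) (a i)

theorem contentIdeal_finPoly {r : ℕ} (a : Fin r → R) :
    (finPoly a).contentIdeal = Ideal.span (Set.range a) := by
  refine le_antisymm (Ideal.span_le.2 fun x hx => ?_) (Ideal.span_le.2 ?_)
  · obtain ⟨n, -, rfl⟩ := Polynomial.mem_coeffs_iff.1 hx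
    simp only [finPoly, Polynomial.finsetSum_coeff, Polynomial.coeff_monomial]
    refine sum_mem fun i _ => ?_
    split_ifs
    · exact Ideal.subset_span ⟨i, rfl⟩
    · exact zero_mem _
  · rintro _ ⟨j, rfl⟩
    have : (finPoly a).coeff j = a j := by
      simp only [finPoly, Polynomial.finsetSum_coeff, Polynomial.coeff_monomial, Fin.val_inj]
      simp
    rw [← this]
    exact Polynomial.coeff_mem_contentIdeal _ _

theorem natDegree_finPoly_le {r : ℕ} (a : Fin (r + 1) → R) : (finPoly a).natDegree ≤ r :=
  Polynomial.natDegree_sum_le_of_forall_le _ _ fun i _ =>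
    (Polynomial.natDegree_monomial_le _).trans (Nat.le_of_lt_succ i.2)

theorem ara_inf_le {I J : Ideal R} (hI : I.FG) (hJ : J.FG) {p q : ℕ} (hp : ara I = p + 1)
    (hq : ara J = q + 1) : ara (I ⊓ J) ≤ p + q + 1 := by
  obtain ⟨a, ha⟩ := exists_radical_span_range_eq hI hp
  obtain ⟨b, hb⟩ := exists_radical_span_range_eq hJ hq
  refine ara_le (fun k : Fin (p + q + 1) => (finPoly a * finPoly b).coeff k) ?_
  have hspan : Ideal.span (Set.range fun k : Fin (p + q + 1) =>
      (finPoly a * finPoly b).coeff k) = (finPoly a * finPoly b).contentIdeal := by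
    refine le_antisymm (Ideal.span_le.2 ?_) (Ideal.span_le.2 fun x hx => ?_)
    · rintro _ ⟨k, rfl⟩
      exact Polynomial.coeff_mem_contentIdeal _ _
    · obtain ⟨n, hn, rfl⟩ := Polynomial.mem_coeffs_iff.1 hx
      have hle : n ≤ p + q := (Polynomial.le_natDegree_of_mem_supp n hn).trans
        (Polynomial.natDegree_mul_le_of_le (natDegree_finPoly_le a) (natDegree_finPoly_le b))
      exact Ideal.subset_span ⟨⟨n, Nat.lt_succ_of_le hle⟩, rfl⟩
  have hprod : (finPoly a * finPoly b).contentIdeal.radical =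
      ((finPoly a).contentIdeal * (finPoly b).contentIdeal).radical :=
    le_antisymm (Ideal.radical_mono (Polynomial.contentIdeal_mul_le_mul_contentIdeal _ _))
      (Ideal.radical_le_radical_iff.2
        Polynomial.mul_contentIdeal_le_radical_contentIdeal_mul)
  rw [hspan, hprod, Ideal.radical_mul, contentIdeal_finPoly, contentIdeal_finPoly, ha, hb,
    Ideal.radical_inf]

theorem ara_bot_eq_pdim (R : Type u) [CommRing R] :
    (ara (⊥ : Ideal R) : ℕ∞) = pdim R (ModuleCat.of R (R ⧸ (⊥ : Ideal R))) := by
  have hara : ara (⊥ : Ideal R) = 0 := Nat.le_zero.1 (ara_le (Fin.elim0 : Fin 0 → R) (by simp))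
  have : Module.Projective R (R ⧸ (⊥ : Ideal R)) :=
    Module.Projective.of_equiv (Submodule.quotEquivOfEqBot (⊥ : Ideal R) rfl).symm
  have hpdim := (pdim_le_iff (ModuleCat.of R (R ⧸ (⊥ : Ideal R))) 0).2
    ((hasProjectiveDimensionLT_one_iff_projective _).2 this)
  rw [hara, eq_comm]
  exact nonpos_iff_eq_zero.1 hpdim

theorem eq_bot_of_ara_eq_zero [IsDomain R] {I : Ideal R} (hI : I.FG)
    (h : ara I = 0) : I = ⊥ := by
  obtain ⟨a, ha⟩ := exists_radical_span_range_eq hI h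
  rw [Set.range_eq_empty, Ideal.span_empty, Ideal.radical_bot_of_isReduced] at ha
  exact le_bot_iff.1 (ha ▸ Ideal.le_radical)

end SchmittVogel

section Squarefree

variable {K : Type u} [Field K] {V : Type}

theorem sqfIdeal_union (A : ℕ → Finset V) (G₁ G₂ : Finset ℕ) :
    sqfIdeal K A (G₁ ∪ G₂) = sqfIdeal K A G₁ ⊔ sqfIdeal K A G₂ := by
  rw [sqfIdeal, sqfIdeal, sqfIdeal, Finset.coe_union, Set.image_union, Ideal.span_union]

variable [DecidableEq V]

theorem sqfIdeal_inf (A : ℕ → Finset V) (G₁ G₂ : Finset ℕ) :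
    sqfIdeal K A G₁ ⊓ sqfIdeal K A G₂ =
      sqfIdeal K (fun n => A n.unpair.1 ∪ A n.unpair.2)
        ((G₁ ×ˢ G₂).image fun x => Nat.pair x.1 x.2) := by
  ext p
  simp only [Submodule.mem_inf, mem_sqfIdeal_iff, Finset.exists_mem_image,
    Finset.mem_product, Prod.exists, Nat.unpair_pair, Finset.forall_mem_union]
  refine ⟨fun h E hE => ?_, fun h => ⟨fun E hE => ?_, fun E hE => ?_⟩⟩
  · obtain ⟨i, hi, hi'⟩ := h.1 E hE
    obtain ⟨j, hj, hj'⟩ := h.2 E hE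
    exact ⟨i, j, ⟨hi, hj⟩, hi', hj'⟩
  · obtain ⟨i, j, h, h', -⟩ := h E hE
    exact ⟨i, h.1, h'⟩
  · obtain ⟨i, j, h, -, h'⟩ := h E hE
    exact ⟨j, h.2, h'⟩

variable [Fintype V]

theorem pdim_quotient_sqfIdeal_le_ara (A : ℕ → Finset V) (G : Finset ℕ) :
    pdim (MvPolynomial V K) (ModuleCat.of (MvPolynomial V K)
      (MvPolynomial V K ⧸ sqfIdeal K A G)) ≤ ara (sqfIdeal K A G) := by
  rw [pdim_le_iff]
  by_contra hnot
  obtain ⟨a, ha⟩ := exists_radical_span_range_eq (IsNoetherian.noetherian (sqfIdeal K A G)) rfl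
  have key : ∀ d : ℕ, ¬ HasProjectiveDimensionLT (ModuleCat.of (MvPolynomial V K)
      (MvPolynomial V K ⧸ sqfIdeal K A G)) (ara (sqfIdeal K A G) + 1 + d) := fun d => by
    induction d with
    | zero => exact hnot
    | succ d ih =>
      intro h
      obtain ⟨W, hW⟩ := exists_strandNonexact_of_hasProjectiveDimensionLT
        (k := ara (sqfIdeal K A G) + d) (by convert h using 1; lia) (by convert ih using 2; lia)
      have := hW.le_of_radical_eq a ha
      lia
  have := hasProjectiveDimensionLT_card_add_one (K := K) A G
  exact key G.card (hasProjectiveDimensionLT_of_ge _ (G.card + 1) _ (by lia))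

theorem exists_strandNonexact_of_pdim_eq {A : ℕ → Finset V} {G : Finset ℕ} {k : ℕ}
    (h : ((k + 1 : ℕ) : ℕ∞) = pdim (MvPolynomial V K) (ModuleCat.of (MvPolynomial V K)
      (MvPolynomial V K ⧸ sqfIdeal K A G))) : ∃ W, StrandNonexact K A G (k + 1) W := by
  refine exists_strandNonexact_of_hasProjectiveDimensionLT ((pdim_le_iff _ _).1 h.ge) fun hlt => ?_
  have := (pdim_le_iff _ _).2 hlt
  rw [← h, Nat.cast_le] at this
  lia

theorem pdim_quotient_sqfIdeal_inf_ge {A : ℕ → Finset V} {G₁ G₂ : Finset ℕ}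
    (hlt : ∀ i ∈ G₁, ∀ j ∈ G₂, i < j) (hlab : Disjoint (lab A G₁) (lab A G₂)) {k₁ k₂ : ℕ}
    (h₁ : ((k₁ + 1 : ℕ) : ℕ∞) = pdim (MvPolynomial V K) (ModuleCat.of (MvPolynomial V K)
      (MvPolynomial V K ⧸ sqfIdeal K A G₁)))
    (h₂ : ((k₂ + 1 : ℕ) : ℕ∞) = pdim (MvPolynomial V K) (ModuleCat.of (MvPolynomial V K)
      (MvPolynomial V K ⧸ sqfIdeal K A G₂))) :
    ((k₁ + k₂ + 1 : ℕ) : ℕ∞) ≤ pdim (MvPolynomial V K) (ModuleCat.of (MvPolynomial V K)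
      (MvPolynomial V K ⧸ (sqfIdeal K A G₁ ⊓ sqfIdeal K A G₂))) := by
  rw [Nat.cast_add_one, Order.add_one_le_iff_of_not_isMax (by simp)]
  by_contra! hle
  rw [pdim_le_iff] at hle
  obtain ⟨W₁, hW₁⟩ := exists_strandNonexact_of_pdim_eq h₁
  obtain ⟨W₂, hW₂⟩ := exists_strandNonexact_of_pdim_eq h₂
  have hW : StrandNonexact K A (G₁ ∪ G₂) (k₁ + k₂ + 1 + 1) (W₁ ∪ W₂) := by
    have := hW₁.join hlt hlab hW₂
    rwa [show k₁ + 1 + (k₂ + 1) = k₁ + k₂ + 1 + 1 by lia] at this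
  refine hW.not_hasProjectiveDimensionLT ?_
  rw [sqfIdeal_union]
  have hd₁ := (pdim_le_iff _ _).1 h₁.ge
  have hd₂ := (pdim_le_iff _ _).1 h₂.ge
  exact hasProjectiveDimensionLT_quotient_sup hle
    (hasProjectiveDimensionLT_of_ge _ _ _ (by lia : k₁ + 1 + 1 ≤ _))
    (hasProjectiveDimensionLT_of_ge _ _ _ (by lia : k₂ + 1 + 1 ≤ _))

theorem ara_sqfIdeal_inf_eq_pdim {A : ℕ → Finset V} {G₁ G₂ : Finset ℕ}
    (hlt : ∀ i ∈ G₁, ∀ j ∈ G₂, i < j) (hlab : Disjoint (lab A G₁) (lab A G₂))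
    (h₁ : (ara (sqfIdeal K A G₁) : ℕ∞) = pdim (MvPolynomial V K)
      (ModuleCat.of (MvPolynomial V K) (MvPolynomial V K ⧸ sqfIdeal K A G₁)))
    (h₂ : (ara (sqfIdeal K A G₂) : ℕ∞) = pdim (MvPolynomial V K)
      (ModuleCat.of (MvPolynomial V K) (MvPolynomial V K ⧸ sqfIdeal K A G₂))) :
    (ara (sqfIdeal K A G₁ ⊓ sqfIdeal K A G₂) : ℕ∞) = pdim (MvPolynomial V K)
      (ModuleCat.of (MvPolynomial V K)
        (MvPolynomial V K ⧸ (sqfIdeal K A G₁ ⊓ sqfIdeal K A G₂))) := by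
  have hfg : ∀ I : Ideal (MvPolynomial V K), I.FG := IsNoetherian.noetherian
  rcases hk₁ : ara (sqfIdeal K A G₁) with _ | k₁
  · rw [eq_bot_of_ara_eq_zero (hfg _) hk₁, bot_inf_eq]
    exact ara_bot_eq_pdim _
  rcases hk₂ : ara (sqfIdeal K A G₂) with _ | k₂
  · rw [eq_bot_of_ara_eq_zero (hfg _) hk₂, inf_bot_eq]
    exact ara_bot_eq_pdim _
  rw [hk₁] at h₁
  rw [hk₂] at h₂
  refine le_antisymm ((Nat.cast_le.2 (ara_inf_le (hfg _) (hfg _) hk₁ hk₂)).trans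
    (pdim_quotient_sqfIdeal_inf_ge hlt hlab h₁ h₂)) ?_
  rw [sqfIdeal_inf]
  exact pdim_quotient_sqfIdeal_le_ara _ _

end Squarefree

theorem ara_inf_eq_pdim
    (K : Type u) [Field K] (n μ₁ μ₂ : ℕ)
    (A₁ : Fin μ₁ → Finset (Fin n)) (A₂ : Fin μ₂ → Finset (Fin n))
    (hmin₁ : ∀ i j : Fin μ₁, i ≠ j → ¬ A₁ i ⊆ A₁ j)
    (hmin₂ : ∀ i j : Fin μ₂, i ≠ j → ¬ A₂ i ⊆ A₂ j)
    (hdisj : ∀ (i : Fin μ₁) (j : Fin μ₂), Disjoint (A₁ i) (A₂ j))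
    (I₁ I₂ : Ideal (MvPolynomial (Fin n) K))
    (hI₁ : I₁ = Ideal.span (Set.range fun i : Fin μ₁ =>
      ∏ v ∈ A₁ i, (X v : MvPolynomial (Fin n) K)))
    (hI₂ : I₂ = Ideal.span (Set.range fun i : Fin μ₂ =>
      ∏ v ∈ A₂ i, (X v : MvPolynomial (Fin n) K)))
    (h₁ : (ara I₁ : ℕ∞) = pdim (MvPolynomial (Fin n) K)
      (ModuleCat.of (MvPolynomial (Fin n) K) (MvPolynomial (Fin n) K ⧸ I₁)))
    (h₂ : (ara I₂ : ℕ∞) = pdim (MvPolynomial (Fin n) K)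
      (ModuleCat.of (MvPolynomial (Fin n) K) (MvPolynomial (Fin n) K ⧸ I₂))) :
    (ara (I₁ ⊓ I₂) : ℕ∞) = pdim (MvPolynomial (Fin n) K)
      (ModuleCat.of (MvPolynomial (Fin n) K) (MvPolynomial (Fin n) K ⧸ (I₁ ⊓ I₂))) := by
  let A : ℕ → Finset (Fin n) := fun k => if h : k < μ₁ + μ₂ then Fin.append A₁ A₂ ⟨k, h⟩ else ∅
  let G₁ := Finset.univ.image fun i : Fin μ₁ => (Fin.castAdd μ₂ i : ℕ)
  let G₂ := Finset.univ.image fun j : Fin μ₂ => (Fin.natAdd μ₁ j : ℕ)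
  have hA₁ : ∀ i : Fin μ₁, A (Fin.castAdd μ₂ i) = A₁ i := fun i =>
    (dif_pos (Fin.castAdd μ₂ i).2).trans (Fin.append_left A₁ A₂ i)
  have hA₂ : ∀ j : Fin μ₂, A (Fin.natAdd μ₁ j) = A₂ j := fun j =>
    (dif_pos (Fin.natAdd μ₁ j).2).trans (Fin.append_right A₁ A₂ j)
  have hG₁ : I₁ = sqfIdeal K A G₁ := by
    rw [hI₁, sqfIdeal, Finset.coe_image, Finset.coe_univ, Set.image_univ, ← Set.range_comp]
    exact congrArg (fun f => Ideal.span (Set.range f)) (funext fun i => by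
      rw [Function.comp_apply, hA₁, sqfMon])
  have hG₂ : I₂ = sqfIdeal K A G₂ := by
    rw [hI₂, sqfIdeal, Finset.coe_image, Finset.coe_univ, Set.image_univ, ← Set.range_comp]
    exact congrArg (fun f => Ideal.span (Set.range f)) (funext fun j => by
      rw [Function.comp_apply, hA₂, sqfMon])
  subst hG₁ hG₂
  refine ara_sqfIdeal_inf_eq_pdim ?_ ?_ h₁ h₂
  · simp only [G₁, G₂, Finset.forall_mem_image, Fin.val_castAdd, Fin.val_natAdd]
    intro i _ j _
    lia
  · simp only [lab, G₁, G₂, Finset.disjoint_biUnion_left, Finset.disjoint_biUnion_right,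
      Finset.forall_mem_image]
    intro i _ j _
    rw [hA₁, hA₂]
    exact hdisj _ _
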